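/- (Start of the moving spheres.) Let n ≥ 2 and 0 < μ < n. Suppose u ∈ Cⁿ(ℝⁿ) satisfies condition (B) and the integral equation (IE). Then there exists λ₀ > 0 such that for every λ ≥ λ₀ and every x ∈ ℝⁿ with 0 < |x| < λ, one has w_{λ,0}(x) ≥ 0 and z_{λ,0}(x) ≥ 0. -/

import Mathlib

open MeasureTheory Real Filter Metric

noncomputable section

/-- The nonlocal term `v(x) = ∫ e^{((2n-μ)/2) u(y)} / |x-y|^μ dy`. -/
noncomputable def V (n : ℕ) (μ : ℝ) (u : EuclideanSpace ℝ (Fin n) → ℝ)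
    (x : EuclideanSpace ℝ (Fin n)) : ℝ :=
  ∫ y : EuclideanSpace ℝ (Fin n),
    Real.exp ((2 * n - μ) / 2 * u y) / ‖x - y‖ ^ μ

/-- `βₙ = 2^{n-1} Γ(n/2+1) Γ(n/2) ωₙ` with `ωₙ` the volume of the unit ball in `ℝⁿ`. -/
noncomputable def betaN (n : ℕ) : ℝ :=
  2 ^ (n - 1) * Real.Gamma ((n : ℝ) / 2 + 1) * Real.Gamma ((n : ℝ) / 2) *
    (volume (Metric.ball (0 : EuclideanSpace ℝ (Fin n)) 1)).toReal

/-- Condition (B): finite weighted volume and finite total curvature. -/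
def CondB (n : ℕ) (μ : ℝ) (u : EuclideanSpace ℝ (Fin n) → ℝ) : Prop :=
  Integrable (fun y : EuclideanSpace ℝ (Fin n) => Real.exp ((2 * n - μ) / 2 * u y)) ∧
  Integrable (fun p : EuclideanSpace ℝ (Fin n) × EuclideanSpace ℝ (Fin n) =>
    Real.exp ((2 * n - μ) / 2 * u p.1) * Real.exp ((2 * n - μ) / 2 * u p.2) / ‖p.1 - p.2‖ ^ μ)

/-- The integral equation (IE). -/
def IE (n : ℕ) (μ : ℝ) (u : EuclideanSpace ℝ (Fin n) → ℝ) : Prop :=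
  ∃ C : ℝ, ∀ x : EuclideanSpace ℝ (Fin n), u x = (1 / betaN n) *
    (∫ y, Real.log ((‖y‖ + 1) / ‖x - y‖) * (V n μ u y * Real.exp ((2 * n - μ) / 2 * u y))) + C

/-- `α = (1/βₙ) ∫ v(y) e^{((2n-μ)/2) u(y)} dy`. -/
noncomputable def alphaC (n : ℕ) (μ : ℝ) (u : EuclideanSpace ℝ (Fin n) → ℝ) : ℝ :=
  (1 / betaN n) * ∫ y, V n μ u y * Real.exp ((2 * n - μ) / 2 * u y)

/-- `w_{λ,b}(x) = u(b + x/|x|²) − 2 ln|x| − u(b + x/λ²) + 2 ln λ`. -/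
noncomputable def wMS (n : ℕ) (u : EuclideanSpace ℝ (Fin n) → ℝ)
    (b : EuclideanSpace ℝ (Fin n)) (l : ℝ) (x : EuclideanSpace ℝ (Fin n)) : ℝ :=
  u (b + (‖x‖ ^ 2)⁻¹ • x) - 2 * Real.log ‖x‖ - u (b + (l ^ 2)⁻¹ • x) + 2 * Real.log l

/-- `z_{λ,b}(x) = |x|^{−μ} v(b + x/|x|²) − λ^{−μ} v(b + x/λ²)`. -/
noncomputable def zMS (n : ℕ) (μ : ℝ) (u : EuclideanSpace ℝ (Fin n) → ℝ)
    (b : EuclideanSpace ℝ (Fin n)) (l : ℝ) (x : EuclideanSpace ℝ (Fin n)) : ℝ :=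
  ‖x‖ ^ (-μ) * V n μ u (b + (‖x‖ ^ 2)⁻¹ • x) - l ^ (-μ) * V n μ u (b + (l ^ 2)⁻¹ • x)

/-- The critical moving-spheres radius `λ_b`. -/
noncomputable def lambdaB (n : ℕ) (μ : ℝ) (u : EuclideanSpace ℝ (Fin n) → ℝ)
    (b : EuclideanSpace ℝ (Fin n)) : ℝ :=
  sInf {l : ℝ | 0 < l ∧ ∀ ρ : ℝ, l ≤ ρ → ∀ x : EuclideanSpace ℝ (Fin n),
    0 < ‖x‖ → ‖x‖ < ρ → 0 ≤ wMS n u b ρ x ∧ 0 ≤ zMS n μ u b ρ x}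

open scoped Topology

lemma integrableOn_ball_norm_rpow_neg {n : ℕ} (hn : 1 ≤ n) {p : ℝ} (hp : p < n) :
    IntegrableOn (fun w : EuclideanSpace ℝ (Fin n) => ‖w‖ ^ (-p)) (ball 0 1) := by
  have : Nonempty (Fin n) := ⟨⟨0, hn⟩⟩
  rw [integrableOn_fun_norm_addHaar (μ := volume) (f := fun r : ℝ => r ^ (-p))]
  have h := (intervalIntegral.intervalIntegrable_rpow' (a := 0) (b := 1) (r := (n : ℝ) - 1 - p)
    (by linarith))
  rw [intervalIntegrable_iff_integrableOn_Ioo_of_le zero_le_one] at h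
  refine h.congr_fun (fun y hy => ?_) measurableSet_Ioo
  simp only [finrank_euclideanSpace, Fintype.card_fin, smul_eq_mul]
  rw [← Real.rpow_natCast, ← Real.rpow_add hy.1, Nat.cast_sub hn]
  congr 1
  push_cast
  ring

/-- The part of the kernel `‖w‖ ^ (-p)` near the origin. -/
noncomputable def nearKernel (n : ℕ) (p : ℝ) : EuclideanSpace ℝ (Fin n) → ℝ :=
  (ball 0 1).indicator (fun w => ‖w‖ ^ (-p))

lemma integrable_nearKernel {n : ℕ} (hn : 1 ≤ n) {p : ℝ} (hp : p < n) :
    Integrable (nearKernel n p) :=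
  (integrable_indicator_iff measurableSet_ball).2 (integrableOn_ball_norm_rpow_neg hn hp)

lemma nearKernel_nonneg {n : ℕ} (p : ℝ) (w : EuclideanSpace ℝ (Fin n)) : 0 ≤ nearKernel n p w :=
  Set.indicator_nonneg (fun _ _ => by positivity) _

/-- Local boundedness of a real function. -/
def BddOnBalls {n : ℕ} (g : EuclideanSpace ℝ (Fin n) → ℝ) : Prop :=
  ∀ R : ℝ, ∃ M : ℝ, 0 ≤ M ∧ ∀ y, ‖y‖ ≤ R → |g y| ≤ M

lemma Continuous.bddOnBalls {n : ℕ} {g : EuclideanSpace ℝ (Fin n) → ℝ} (hg : Continuous g) :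
    BddOnBalls g := by
  intro R
  obtain ⟨M, hM⟩ :=
    (isCompact_closedBall (0 : EuclideanSpace ℝ (Fin n)) R).exists_bound_of_continuousOn hg.continuousOn
  refine ⟨max M 0, le_max_right _ _, fun y hy => ?_⟩
  exact (hM y (by simpa using hy)).trans (le_max_left _ _)

lemma norm_div_rpow_le {n : ℕ} {p : ℝ} (hp : 0 ≤ p) {g : EuclideanSpace ℝ (Fin n) → ℝ} {R M : ℝ}
    (hM0 : 0 ≤ M) (hM : ∀ y, ‖y‖ ≤ R + 1 → |g y| ≤ M) {x : EuclideanSpace ℝ (Fin n)}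
    (hx : ‖x‖ ≤ R) (y : EuclideanSpace ℝ (Fin n)) :
    ‖g y / ‖x - y‖ ^ p‖ ≤ M * nearKernel n p (x - y) + ‖g y‖ := by
  have h0 : 0 ≤ ‖x - y‖ ^ p := by positivity
  rw [norm_div, Real.norm_of_nonneg h0]
  by_cases h : ‖x - y‖ < 1
  · have hy : ‖y‖ ≤ R + 1 := by
      have := norm_sub_le x (x - y)
      rw [sub_sub_cancel] at this
      linarith
    have : nearKernel n p (x - y) = ‖x - y‖ ^ (-p) :=
      Set.indicator_of_mem (by simpa using h) _
    rw [this, Real.rpow_neg (norm_nonneg _), div_eq_mul_inv]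
    have := mul_le_mul_of_nonneg_right (hM y hy) (inv_nonneg.2 h0)
    rw [← Real.norm_eq_abs] at this
    linarith [norm_nonneg (g y)]
  · have h1 : 1 ≤ ‖x - y‖ ^ p := Real.one_le_rpow (not_lt.1 h) hp
    have h2 : ‖g y‖ / ‖x - y‖ ^ p ≤ ‖g y‖ := div_le_self (norm_nonneg _) h1
    have := mul_nonneg hM0 (nearKernel_nonneg p (x - y))
    linarith

lemma Integrable.div_norm_sub_rpow {n : ℕ} (hn : 1 ≤ n) {p : ℝ} (hp : 0 ≤ p) (hpn : p < n)
    {g : EuclideanSpace ℝ (Fin n) → ℝ} (hg : Integrable g) (hb : BddOnBalls g)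
    (x : EuclideanSpace ℝ (Fin n)) :
    Integrable (fun y => g y / ‖x - y‖ ^ p) := by
  obtain ⟨M, hM0, hM⟩ := hb (‖x‖ + 1)
  refine Integrable.mono'
    ((((integrable_nearKernel hn hpn).comp_sub_left x).const_mul M).add hg.norm) ?_
    (.of_forall fun y => norm_div_rpow_le hp hM0 hM le_rfl y)
  exact (hg.1.aemeasurable.div (by fun_prop)).aestronglyMeasurable

lemma exists_integral_abs_div_norm_sub_rpow_le {n : ℕ} (hn : 1 ≤ n) {p : ℝ} (hp : 0 ≤ p)
    (hpn : p < n) {g : EuclideanSpace ℝ (Fin n) → ℝ} (hg : Integrable g) (hb : BddOnBalls g) :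
    BddOnBalls (fun x => ∫ y, ‖g y / ‖x - y‖ ^ p‖) := by
  intro R
  obtain ⟨M, hM0, hM⟩ := hb (R + 1)
  have hK := integral_nonneg (μ := volume) (f := nearKernel n p) (nearKernel_nonneg p)
  have hG := integral_nonneg (μ := volume) (f := fun y => ‖g y‖) (fun y => norm_nonneg (g y))
  refine ⟨M * (∫ w, nearKernel n p w) + ∫ y, ‖g y‖, by positivity, fun x hx => ?_⟩
  rw [abs_of_nonneg (integral_nonneg fun y => norm_nonneg _)]
  have hi := (((integrable_nearKernel hn hpn).comp_sub_left x).const_mul M)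
  calc ∫ y, ‖g y / ‖x - y‖ ^ p‖ ≤ ∫ y, (M * nearKernel n p (x - y) + ‖g y‖) :=
        integral_mono_of_nonneg (.of_forall fun y => norm_nonneg _) (hi.add hg.norm)
          (.of_forall fun y => norm_div_rpow_le hp hM0 hM hx y)
    _ = _ := by
        rw [integral_add hi hg.norm, integral_const_mul, integral_sub_left_eq_self]

lemma bddOnBalls_integral_div {n : ℕ} (hn : 1 ≤ n) {p : ℝ} (hp : 0 ≤ p)
    (hpn : p < n) {g : EuclideanSpace ℝ (Fin n) → ℝ} (hg : Integrable g) (hb : BddOnBalls g) :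
    BddOnBalls (fun x => ∫ y, g y / ‖x - y‖ ^ p) := by
  intro R
  obtain ⟨M, hM0, hM⟩ := exists_integral_abs_div_norm_sub_rpow_le hn hp hpn hg hb R
  refine ⟨M, hM0, fun x hx => ?_⟩
  exact (norm_integral_le_integral_norm _).trans ((le_abs_self _).trans (hM x hx))

lemma BddOnBalls.mul {n : ℕ} {f g : EuclideanSpace ℝ (Fin n) → ℝ} (hf : BddOnBalls f)
    (hg : BddOnBalls g) : BddOnBalls (fun x => f x * g x) := by
  intro R
  obtain ⟨M, hM0, hM⟩ := hf R
  obtain ⟨N, hN0, hN⟩ := hg R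
  refine ⟨M * N, by positivity, fun y hy => ?_⟩
  rw [abs_mul]
  exact mul_le_mul (hM y hy) (hN y hy) (abs_nonneg _) hM0

lemma log_norm_add_div_le {F : Type*} [NormedAddCommGroup F] [InnerProductSpace ℝ F] {w h : F}
    (hw : w ≠ 0) (hwh : w + h ≠ 0) :
    Real.log (‖w + h‖ / ‖w‖) ≤ inner ℝ w h / ‖w‖ ^ 2 + 2 * (‖h‖ / ‖w‖) ^ (3 / 2 : ℝ) := by
  have hw0 : 0 < ‖w‖ := norm_pos_iff.2 hw
  have hwh0 : 0 < ‖w + h‖ := norm_pos_iff.2 hwh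
  set r := ‖h‖ / ‖w‖ with hr
  have hr0 : 0 ≤ r := by positivity
  set c := inner ℝ w h / ‖w‖ ^ 2 with hc
  have hcr : -r ≤ c := by
    have h1 := neg_le_of_abs_le (abs_real_inner_le_norm w h)
    rw [hc, hr, le_div_iff₀ (by positivity)]
    calc -(‖h‖ / ‖w‖) * ‖w‖ ^ 2 = -(‖w‖ * ‖h‖) := by field_simp
      _ ≤ _ := h1
  rcases le_total r 1 with h1 | h1
  · have hsq : (‖w + h‖ / ‖w‖) ^ 2 = 1 + 2 * c + r ^ 2 := by
      rw [div_pow, norm_add_sq_real, hc, hr]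
      field_simp
    have h2 := Real.log_le_sub_one_of_pos (show 0 < (‖w + h‖ / ‖w‖) ^ 2 by positivity)
    rw [Real.log_pow, hsq] at h2
    have h3 : r ^ 2 ≤ r ^ (3 / 2 : ℝ) := by
      rw [← Real.rpow_natCast]
      exact Real.rpow_le_rpow_of_exponent_ge_of_imp hr0 h1 (by norm_num) (by norm_num)
    have h4 : 0 ≤ r ^ (3 / 2 : ℝ) := by positivity
    push_cast at h2
    linarith
  · have h2 : ‖w + h‖ / ‖w‖ ≤ 1 + r := by
      rw [div_le_iff₀ hw0, hr]
      have := norm_add_le w h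
      field_simp
      linarith
    have h3 : Real.log (‖w + h‖ / ‖w‖) ≤ r := by
      have := Real.log_le_sub_one_of_pos (show 0 < ‖w + h‖ / ‖w‖ by positivity)
      linarith
    have h4 : r ≤ r ^ (3 / 2 : ℝ) := by
      simpa using Real.rpow_le_rpow_of_exponent_le h1 (show (1 : ℝ) ≤ 3 / 2 by norm_num)
    linarith

lemma neg_log_norm_add_one_le {F : Type*} [NormedAddCommGroup F] {x y : F} (h : x ≠ y) :
    -Real.log (‖x‖ + 1) ≤ Real.log ((‖y‖ + 1) / ‖x - y‖) := by
  have hw : 0 < ‖x - y‖ := norm_pos_iff.2 (sub_ne_zero.2 h)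
  rw [← Real.log_inv]
  apply Real.log_le_log (by positivity)
  rw [inv_eq_one_div, div_le_div_iff₀ (by positivity) hw]
  nlinarith [norm_sub_le x y, norm_nonneg x, norm_nonneg y,
    mul_nonneg (norm_nonneg x) (norm_nonneg y)]

lemma log_add_one_div_norm_sub_le {F : Type*} [NormedAddCommGroup F] {x y : F} (h : x ≠ y) :
    Real.log ((‖y‖ + 1) / ‖x - y‖) ≤ (‖x‖ + 1) / ‖x - y‖ := by
  have hw : 0 < ‖x - y‖ := norm_pos_iff.2 (sub_ne_zero.2 h)
  have h1 := Real.log_le_sub_one_of_pos (show 0 < (‖y‖ + 1) / ‖x - y‖ by positivity)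
  have h2 : (‖y‖ + 1) / ‖x - y‖ - 1 ≤ (‖x‖ + 1) / ‖x - y‖ := by
    rw [sub_le_iff_le_add, div_add_one hw.ne', div_le_div_iff_of_pos_right hw]
    linarith [norm_sub_norm_le y x, norm_sub_rev x y]
  linarith

lemma abs_log_add_one_div_norm_sub_le {F : Type*} [NormedAddCommGroup F] (x y : F) :
    |Real.log ((‖y‖ + 1) / ‖x - y‖)| ≤ Real.log (‖x‖ + 1) + (‖x‖ + 1) / ‖x - y‖ := by
  have h0 : 0 ≤ Real.log (‖x‖ + 1) := Real.log_nonneg (by linarith [norm_nonneg x])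
  have h1 : 0 ≤ (‖x‖ + 1) / ‖x - y‖ := by positivity
  rcases eq_or_ne x y with rfl | h
  · simpa using h0
  rw [abs_le]
  constructor
  · linarith [neg_log_norm_add_one_le h]
  · linarith [log_add_one_div_norm_sub_le h]

lemma ae_ne_point {n : ℕ} (hn : 1 ≤ n) (x : EuclideanSpace ℝ (Fin n)) :
    ∀ᵐ y : EuclideanSpace ℝ (Fin n), x ≠ y := by
  have : Nonempty (Fin n) := ⟨⟨0, hn⟩⟩
  filter_upwards [(Set.finite_singleton x).countable.ae_notMem volume] with y hy h
  exact hy h.symm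

lemma integrable_log_mul {n : ℕ} (hn : 2 ≤ n) {f : EuclideanSpace ℝ (Fin n) → ℝ}
    (hf : Integrable f) (hb : BddOnBalls f) (x : EuclideanSpace ℝ (Fin n)) :
    Integrable (fun y => Real.log ((‖y‖ + 1) / ‖x - y‖) * f y) := by
  have h1 := (Integrable.div_norm_sub_rpow (by omega) zero_le_one
    (by exact_mod_cast (by omega : 1 < n)) hf hb x).norm
  refine Integrable.mono' ((hf.norm.const_mul (Real.log (‖x‖ + 1))).add (h1.const_mul (‖x‖ + 1)))
    ?_ (.of_forall fun y => ?_)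
  · have : Measurable (fun y => Real.log ((‖y‖ + 1) / ‖x - y‖)) := by fun_prop
    exact this.aestronglyMeasurable.mul hf.1
  · have h := mul_le_mul_of_nonneg_right (abs_log_add_one_div_norm_sub_le x y) (norm_nonneg (f y))
    rw [norm_mul, Real.norm_eq_abs]
    refine h.trans (le_of_eq ?_)
    simp only [Real.rpow_one, Pi.add_apply, norm_div, norm_norm]
    ring

lemma abs_inner_div_sq_le {F : Type*} [NormedAddCommGroup F] [InnerProductSpace ℝ F] (w h : F) :
    |inner ℝ w h / ‖w‖ ^ 2| ≤ ‖h‖ / ‖w‖ := by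
  rcases eq_or_ne w 0 with rfl | hw
  · simp
  have hw0 : 0 < ‖w‖ := norm_pos_iff.2 hw
  rw [abs_div, abs_of_nonneg (sq_nonneg ‖w‖), div_le_div_iff₀ (by positivity) hw0]
  nlinarith [abs_real_inner_le_norm w h]

lemma integrable_inner_div_mul {n : ℕ} (hn : 2 ≤ n) {f : EuclideanSpace ℝ (Fin n) → ℝ}
    (hf : Integrable f) (hb : BddOnBalls f) (x h : EuclideanSpace ℝ (Fin n)) :
    Integrable (fun y => inner ℝ (x - y) h / ‖x - y‖ ^ 2 * f y) := by
  have h1 := (Integrable.div_norm_sub_rpow (by omega) zero_le_one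
    (by exact_mod_cast (by omega : 1 < n)) hf hb x).norm
  refine Integrable.mono' (h1.const_mul ‖h‖) ?_ (.of_forall fun y => ?_)
  · have : Measurable (fun y => inner ℝ (x - y) h / ‖x - y‖ ^ 2) := by fun_prop
    exact this.aestronglyMeasurable.mul hf.1
  · have h := mul_le_mul_of_nonneg_right (abs_inner_div_sq_le (x - y) h) (norm_nonneg (f y))
    rw [norm_mul, Real.norm_eq_abs]
    refine h.trans (le_of_eq ?_)
    simp only [Real.rpow_one, norm_div, norm_norm]
    ring

/-- `u` is, up to a constant, the logarithmic potential of `f / β`. -/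
def IsLogPotential {n : ℕ} (β C : ℝ) (f u : EuclideanSpace ℝ (Fin n) → ℝ) : Prop :=
  ∀ x, u x = (1 / β) * (∫ y, Real.log ((‖y‖ + 1) / ‖x - y‖) * f y) + C

lemma IsLogPotential.le_fderiv {n : ℕ} (hn : 2 ≤ n) {β C : ℝ} (hβ : 0 < β)
    {f u : EuclideanSpace ℝ (Fin n) → ℝ}
    (hf : Integrable f) (hb : BddOnBalls f) (hf0 : ∀ y, 0 ≤ f y) (hu : IsLogPotential β C f u)
    {x : EuclideanSpace ℝ (Fin n)} (hd : DifferentiableAt ℝ u x) (h : EuclideanSpace ℝ (Fin n)) :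
    -(1 / β) * (∫ y, inner ℝ (x - y) h / ‖x - y‖ ^ 2 * f y) ≤ fderiv ℝ u x h := by
  set J := ∫ y, inner ℝ (x - y) h / ‖x - y‖ ^ 2 * f y with hJ
  have hS := Integrable.div_norm_sub_rpow (p := 3 / 2) (by omega) (by norm_num)
    (by have : (2 : ℝ) ≤ n := by exact_mod_cast hn
        linarith) hf hb x
  set S := ∫ y, f y / ‖x - y‖ ^ (3 / 2 : ℝ) with hSdef
  have hslope := (hd.hasFDerivAt.hasLineDerivAt h).tendsto_slope_zero_right
  have hlow : Tendsto (fun t : ℝ => (1 / β) * (-J - 2 * t ^ (1 / 2 : ℝ) * ‖h‖ ^ (3 / 2 : ℝ) * S))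
      (𝓝[>] 0) (𝓝 ((1 / β) * (-J - 2 * (0 : ℝ) ^ (1 / 2 : ℝ) * ‖h‖ ^ (3 / 2 : ℝ) * S))) := by
    have : Continuous (fun t : ℝ =>
        (1 / β) * (-J - 2 * t ^ (1 / 2 : ℝ) * ‖h‖ ^ (3 / 2 : ℝ) * S)) := by
      have := Real.continuous_rpow_const (q := 1 / 2) (by norm_num)
      fun_prop
    exact this.continuousAt.tendsto.mono_left nhdsWithin_le_nhds
  have hlim := le_of_tendsto_of_tendsto hlow hslope ?_
  · rw [Real.zero_rpow (by norm_num)] at hlim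
    linarith
  filter_upwards [self_mem_nhdsWithin] with t (ht : 0 < t)
  rw [smul_eq_mul, le_inv_mul_iff₀ ht, hu, hu x, add_sub_add_right_eq_sub, ← mul_sub,
    mul_left_comm]
  refine mul_le_mul_of_nonneg_left ?_ (by positivity)
  rw [← integral_sub (integrable_log_mul hn hf hb _) (integrable_log_mul hn hf hb _)]
  have hI1 := (integrable_inner_div_mul hn hf hb x h).const_mul (-t)
  have hI2 := hS.const_mul (2 * (t ^ (3 / 2 : ℝ) * ‖h‖ ^ (3 / 2 : ℝ)))
  have hpow : t * t ^ (1 / 2 : ℝ) = t ^ (3 / 2 : ℝ) := by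
    nth_rewrite 1 [← Real.rpow_one t]
    rw [← Real.rpow_add ht]
    norm_num
  have heq : t * (-J - 2 * t ^ (1 / 2 : ℝ) * ‖h‖ ^ (3 / 2 : ℝ) * S) =
      ∫ y, (-t * (inner ℝ (x - y) h / ‖x - y‖ ^ 2 * f y) -
        2 * (t ^ (3 / 2 : ℝ) * ‖h‖ ^ (3 / 2 : ℝ)) * (f y / ‖x - y‖ ^ (3 / 2 : ℝ))) := by
    rw [integral_sub hI1 hI2, integral_const_mul, integral_const_mul, ← hJ, ← hSdef, ← hpow]
    ring
  rw [heq]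
  refine integral_mono_ae (hI1.sub hI2)
    ((integrable_log_mul hn hf hb _).sub (integrable_log_mul hn hf hb _)) ?_
  filter_upwards [ae_ne_point (by omega) x, ae_ne_point (by omega) (x + t • h)] with y hy1 hy2
  have hw : x - y ≠ 0 := sub_ne_zero.2 hy1
  have hw2 : x - y + t • h ≠ 0 := by
    rw [sub_add_eq_add_sub]
    exact sub_ne_zero.2 hy2
  have key := log_norm_add_div_le hw hw2
  have e : x + t • h - y = x - y + t • h := by abel
  have hn1 : 0 < ‖x - y‖ := norm_pos_iff.2 hw
  have hn2 : 0 < ‖x - y + t • h‖ := norm_pos_iff.2 hw2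
  have hn3 : 0 < ‖y‖ + 1 := by positivity
  rw [Real.log_div hn2.ne' hn1.ne', inner_smul_right, norm_smul, Real.norm_of_nonneg ht.le,
    Real.div_rpow (by positivity) hn1.le, Real.mul_rpow ht.le (norm_nonneg h)] at key
  rw [e, Real.log_div hn3.ne' hn2.ne', Real.log_div hn3.ne' hn1.ne', ← sub_mul]
  have := mul_le_mul_of_nonneg_right key (hf0 y)
  refine le_trans (le_of_eq ?_) ((neg_le_neg this).trans (le_of_eq ?_))
  · ring
  · ring

lemma IsLogPotential.fderiv_apply {n : ℕ} (hn : 2 ≤ n) {β C : ℝ} (hβ : 0 < β)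
    {f u : EuclideanSpace ℝ (Fin n) → ℝ}
    (hf : Integrable f) (hb : BddOnBalls f) (hf0 : ∀ y, 0 ≤ f y) (hu : IsLogPotential β C f u)
    {x : EuclideanSpace ℝ (Fin n)} (hd : DifferentiableAt ℝ u x) (h : EuclideanSpace ℝ (Fin n)) :
    fderiv ℝ u x h = -(1 / β) * (∫ y, inner ℝ (x - y) h / ‖x - y‖ ^ 2 * f y) := by
  refine le_antisymm ?_ (hu.le_fderiv hn hβ hf hb hf0 hd h)
  have := hu.le_fderiv hn hβ hf hb hf0 hd (-h)
  simp only [inner_neg_right, neg_div, neg_mul, integral_neg, map_neg] at this ⊢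
  linarith

lemma integral_fderiv_self_eq {n : ℕ} {ψ : EuclideanSpace ℝ (Fin n) → ℝ} (hψ : ContDiff ℝ 1 ψ)
    (hc : HasCompactSupport ψ) :
    ∫ x, fderiv ℝ ψ x x = -(n * ∫ x, ψ x) := by
  have hcd : Continuous (fderiv ℝ ψ) := hψ.continuous_fderiv one_ne_zero
  have hcc : HasCompactSupport (fderiv ℝ ψ) := hc.fderiv ℝ
  let e : Fin n → EuclideanSpace ℝ (Fin n) := fun i => EuclideanSpace.single i 1
  have hi1 : ∀ i, Integrable (fun x : EuclideanSpace ℝ (Fin n) => x i * fderiv ℝ ψ x (e i)) := by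
    intro i
    refine Continuous.integrable_of_hasCompactSupport (by fun_prop) ?_
    refine hcc.mono fun x hx h => hx ?_
    simp [h]
  have hi2 : Integrable ψ := hψ.continuous.integrable_of_hasCompactSupport hc
  have hexp : ∀ x, fderiv ℝ ψ x x = ∑ i, x i * fderiv ℝ ψ x (e i) := by
    intro x
    have hx : x = ∑ i, x i • e i := by
      have := (EuclideanSpace.basisFun (Fin n) ℝ).sum_repr x
      simpa [e] using this.symm
    conv_lhs => rw [hx]
    rw [map_sum, ← hx]
    simp
  have hparts : ∀ i, ∫ x : EuclideanSpace ℝ (Fin n), x i * fderiv ℝ ψ x (e i) = -∫ x, ψ x := by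
    intro i
    have hd : ∀ x, fderiv ℝ (fun x : EuclideanSpace ℝ (Fin n) => x i) x (e i) = 1 := by
      intro x
      have : HasFDerivAt (fun x : EuclideanSpace ℝ (Fin n) => x i)
          (EuclideanSpace.proj i : EuclideanSpace ℝ (Fin n) →L[ℝ] ℝ) x :=
        (EuclideanSpace.proj i : EuclideanSpace ℝ (Fin n) →L[ℝ] ℝ).hasFDerivAt
      rw [this.fderiv]
      simp [e]
    have h := integral_mul_fderiv_eq_neg_fderiv_mul_of_integrable (μ := volume)
      (f := fun x : EuclideanSpace ℝ (Fin n) => x i) (g := ψ) (v := e i)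
      (by simpa only [hd, one_mul] using hi2) (hi1 i)
      (by
        refine Continuous.integrable_of_hasCompactSupport (by have := hψ.continuous; fun_prop) ?_
        exact hc.mul_left)
      (fun x _ => by fun_prop) (fun x _ => (hψ.differentiable one_ne_zero) x)
    simpa only [hd, one_mul] using h
  simp only [hexp]
  rw [integral_finsetSum _ fun i _ => hi1 i]
  simp [hparts]

/-- The regularised kernel `(‖w‖ ^ 2 + η) ^ (-μ / 2)`. -/
noncomputable def regKernel {n : ℕ} (μ η : ℝ) (w : EuclideanSpace ℝ (Fin n)) : ℝ :=
  (‖w‖ ^ 2 + η) ^ (-μ / 2)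

lemma regKernel_nonneg {n : ℕ} {μ η : ℝ} (hη : 0 < η) (w : EuclideanSpace ℝ (Fin n)) :
    0 ≤ regKernel μ η w := by
  unfold regKernel
  positivity

lemma contDiff_regKernel {n : ℕ} {μ η : ℝ} (hη : 0 < η) :
    ContDiff ℝ 1 (regKernel (n := n) μ η) := by
  unfold regKernel
  refine ContDiff.rpow_const_of_ne ((contDiff_norm_sq ℝ).add contDiff_const) fun x => ?_
  positivity

lemma fderiv_regKernel {n : ℕ} {μ η : ℝ} (hη : 0 < η) (w h : EuclideanSpace ℝ (Fin n)) :
    fderiv ℝ (regKernel (n := n) μ η) w h =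
      -μ * regKernel μ η w * (inner ℝ w h / (‖w‖ ^ 2 + η)) := by
  have hs : 0 < ‖w‖ ^ 2 + η := by positivity
  have h1 : HasFDerivAt (fun w : EuclideanSpace ℝ (Fin n) => ‖w‖ ^ 2 + η)
      (2 • innerSL ℝ w) w := (hasStrictFDerivAt_norm_sq w).hasFDerivAt.add_const η
  have h2 := h1.rpow_const (p := -μ / 2) (Or.inl hs.ne')
  unfold regKernel
  rw [h2.fderiv, Real.rpow_sub_one hs.ne']
  simp
  field_simp

lemma integral_mul_regKernel {n : ℕ} {μ η : ℝ} (hη : 0 < η)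
    {g φ : EuclideanSpace ℝ (Fin n) → ℝ} (hg : ContDiff ℝ 1 g) (hφ : ContDiff ℝ 1 φ)
    (hc : HasCompactSupport φ) (y : EuclideanSpace ℝ (Fin n)) :
    ∫ x, φ x * fderiv ℝ g x x * regKernel μ η (x - y) =
      -∫ x, g x * regKernel μ η (x - y) * (n * φ x + fderiv ℝ φ x x -
        μ * (inner ℝ (x - y) (φ x • x) / (‖x - y‖ ^ 2 + η))) := by
  have hk : ContDiff ℝ 1 (fun x : EuclideanSpace ℝ (Fin n) => regKernel μ η (x - y)) :=
    (contDiff_regKernel hη).comp (contDiff_id.sub contDiff_const)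
  have hkd : ∀ x h, fderiv ℝ (fun x : EuclideanSpace ℝ (Fin n) => regKernel μ η (x - y)) x h =
      -μ * regKernel μ η (x - y) * (inner ℝ (x - y) h / (‖x - y‖ ^ 2 + η)) := by
    intro x h
    rw [fderiv_comp_sub, fderiv_regKernel hη]
  have hψ : ContDiff ℝ 1 (fun x => φ x * (g x * regKernel μ η (x - y))) := hφ.mul (hg.mul hk)
  have hψc : HasCompactSupport (fun x => φ x * (g x * regKernel μ η (x - y))) := hc.mul_right
  have h := integral_fderiv_self_eq hψ hψc
  have hd : ∀ x, fderiv ℝ (fun x => φ x * (g x * regKernel μ η (x - y))) x x =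
      φ x * fderiv ℝ g x x * regKernel μ η (x - y) +
      g x * regKernel μ η (x - y) * (fderiv ℝ φ x x -
        μ * (inner ℝ (x - y) (φ x • x) / (‖x - y‖ ^ 2 + η))) := by
    intro x
    have e1 := (hφ.differentiable one_ne_zero x).hasFDerivAt
    have e2 := (hg.differentiable one_ne_zero x).hasFDerivAt
    have e3 := (hk.differentiable one_ne_zero x).hasFDerivAt
    rw [(e1.fun_mul (e2.fun_mul e3)).fderiv]
    simp only [add_apply, smul_apply, smul_eq_mul, hkd,
      inner_smul_right]
    ring
  have hkc : Continuous (fun x : EuclideanSpace ℝ (Fin n) => regKernel μ η (x - y)) := hk.continuous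
  have hgc := hg.continuous
  have hφc := hφ.continuous
  have hgd : Continuous (fun x => fderiv ℝ g x x) :=
    (hg.continuous_fderiv one_ne_zero).clm_apply continuous_id
  have hφd : Continuous (fun x => fderiv ℝ φ x x) :=
    (hφ.continuous_fderiv one_ne_zero).clm_apply continuous_id
  have hφdc : HasCompactSupport (fun x => fderiv ℝ φ x x) := by
    refine (hc.fderiv ℝ).mono fun x hx h => hx ?_
    simp [h]
  have hin : Continuous (fun x => inner ℝ (x - y) (φ x • x) / (‖x - y‖ ^ 2 + η)) := by
    refine Continuous.div (by fun_prop) (by fun_prop) fun x => ?_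
    positivity
  have hinc : HasCompactSupport (fun x => inner ℝ (x - y) (φ x • x) / (‖x - y‖ ^ 2 + η)) := by
    refine hc.mono fun x hx h => hx ?_
    simp [h]
  have i1 : Integrable (fun x => φ x * fderiv ℝ g x x * regKernel μ η (x - y)) :=
    Continuous.integrable_of_hasCompactSupport (by fun_prop) (hc.mul_right.mul_right)
  have i2 : Integrable (fun x => g x * regKernel μ η (x - y) * (fderiv ℝ φ x x -
        μ * (inner ℝ (x - y) (φ x • x) / (‖x - y‖ ^ 2 + η)))) := by
    refine Continuous.integrable_of_hasCompactSupport (by fun_prop) (HasCompactSupport.mul_left ?_)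
    exact hφdc.sub hinc.mul_left
  have i3 : Integrable (fun x => g x * regKernel μ η (x - y) * (n * φ x)) :=
    Continuous.integrable_of_hasCompactSupport (by fun_prop) hc.mul_left.mul_left
  simp only [hd] at h
  rw [integral_add i1 i2] at h
  have e : (n : ℝ) * ∫ x, φ x * (g x * regKernel μ η (x - y)) =
      ∫ x, g x * regKernel μ η (x - y) * (n * φ x) := by
    rw [← integral_const_mul]
    congr 1 with x
    ring
  rw [e] at h
  have e' : ∫ x, g x * regKernel μ η (x - y) * (n * φ x + fderiv ℝ φ x x -
        μ * (inner ℝ (x - y) (φ x • x) / (‖x - y‖ ^ 2 + η))) =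
      (∫ x, g x * regKernel μ η (x - y) * (n * φ x)) +
      ∫ x, g x * regKernel μ η (x - y) * (fderiv ℝ φ x x -
        μ * (inner ℝ (x - y) (φ x • x) / (‖x - y‖ ^ 2 + η))) := by
    rw [← integral_add i3 i2]
    congr 1 with x
    ring
  rw [e']
  linarith

lemma tendsto_integral_mul_of_bdd {α : Type*} [MeasurableSpace α] {ν : Measure α} {H c : α → ℝ}
    (hH : Integrable H ν) {ck : ℕ → α → ℝ} {C : ℝ} (hm : ∀ k, AEStronglyMeasurable (ck k) ν)
    (hC : ∀ k, ∀ᵐ p ∂ν, |ck k p| ≤ C)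
    (hl : ∀ᵐ p ∂ν, Tendsto (fun k => ck k p) atTop (𝓝 (c p))) :
    Tendsto (fun k => ∫ p, H p * ck k p ∂ν) atTop (𝓝 (∫ p, H p * c p ∂ν)) := by
  refine tendsto_integral_of_dominated_convergence (fun p => ‖H p‖ * C)
    (fun k => hH.1.mul (hm k)) (hH.norm.mul_const C) (fun k => ?_) ?_
  · filter_upwards [hC k] with p hp
    rw [norm_mul]
    exact mul_le_mul_of_nonneg_left hp (norm_nonneg _)
  · filter_upwards [hl] with p hp
    exact hp.const_mul _

lemma integral_eq_half_integral_add_swap {α : Type*} [MeasurableSpace α] {ν : Measure α}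
    [SFinite ν] {H : α × α → ℝ} (hH : Integrable H (ν.prod ν)) :
    ∫ p, H p ∂(ν.prod ν) = 1 / 2 * ∫ p, (H p + H p.swap) ∂(ν.prod ν) := by
  have h : Integrable (fun p : α × α => H p.swap) (ν.prod ν) := hH.swap
  rw [integral_add hH h, integral_prod_swap]
  ring

lemma ae_prod_fst_ne_snd {n : ℕ} (hn : 1 ≤ n) :
    ∀ᵐ p : EuclideanSpace ℝ (Fin n) × EuclideanSpace ℝ (Fin n), p.1 - p.2 ≠ 0 := by
  have hms : MeasurableSet {p : EuclideanSpace ℝ (Fin n) × EuclideanSpace ℝ (Fin n) |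
      p.1 - p.2 ≠ 0} :=
    (measurableSet_singleton (0 : EuclideanSpace ℝ (Fin n))).compl.preimage
      (measurable_fst.sub measurable_snd)
  rw [Measure.volume_eq_prod]
  refine (Measure.ae_prod_mem_iff_ae_ae_mem hms).2 (.of_forall fun x => ?_)
  filter_upwards [ae_ne_point hn x] with y hy
  exact sub_ne_zero.2 hy

lemma regKernel_le {n : ℕ} {μ η : ℝ} (hμ : 0 < μ) (hη : 0 < η) (w : EuclideanSpace ℝ (Fin n)) :
    regKernel μ η w ≤ η ^ (-μ / 2) :=
  Real.rpow_le_rpow_of_nonpos hη (by nlinarith [norm_nonneg w]) (by linarith)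

lemma continuous_regKernel {n : ℕ} {μ η : ℝ} (hη : 0 < η) :
    Continuous (regKernel (n := n) μ η) := (contDiff_regKernel hη).continuous

lemma integral_regKernel_identity {n : ℕ} {μ η : ℝ} (hμ : 0 < μ) (hη : 0 < η)
    {g φ c : EuclideanSpace ℝ (Fin n) → ℝ} (hg : ContDiff ℝ 1 g) (hgi : Integrable g)
    (hφ : ContDiff ℝ 1 φ) (hφc : HasCompactSupport φ)
    (hc : Continuous c) (hcc : HasCompactSupport c)
    (hgc : ∀ x, φ x * fderiv ℝ g x x = g x * c x) :
    ∫ p : EuclideanSpace ℝ (Fin n) × EuclideanSpace ℝ (Fin n),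
      g p.1 * g p.2 * regKernel μ η (p.1 - p.2) *
        (c p.1 + (n * φ p.1 + fderiv ℝ φ p.1 p.1) - μ / 2 *
          (inner ℝ (p.1 - p.2) (φ p.1 • p.1 - φ p.2 • p.2) / (‖p.1 - p.2‖ ^ 2 + η))) = 0 := by
  have hG : Integrable (fun p : EuclideanSpace ℝ (Fin n) × EuclideanSpace ℝ (Fin n) =>
      g p.1 * g p.2) := hgi.mul_prod hgi
  have hk := continuous_regKernel (n := n) (μ := μ) hη
  have hφcont := hφ.continuous
  have hGk : Integrable (fun p : EuclideanSpace ℝ (Fin n) × EuclideanSpace ℝ (Fin n) =>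
      g p.1 * g p.2 * regKernel μ η (p.1 - p.2)) := by
    refine hG.mul_bdd (c := η ^ (-μ / 2)) ?_ (.of_forall fun p => ?_)
    · exact (hk.comp (continuous_fst.sub continuous_snd)).aestronglyMeasurable
    · rw [Real.norm_of_nonneg (regKernel_nonneg hη _)]
      exact regKernel_le hμ hη _
  have hφd : Continuous (fun x => fderiv ℝ φ x x) :=
    (hφ.continuous_fderiv one_ne_zero).clm_apply continuous_id
  have hφdc : HasCompactSupport (fun x => fderiv ℝ φ x x) := by
    refine (hφc.fderiv ℝ).mono fun x hx h => hx ?_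
    simp [h]
  set d : EuclideanSpace ℝ (Fin n) → ℝ := fun x => c x + (n * φ x + fderiv ℝ φ x x) with hd
  have hdcont : Continuous d := by fun_prop
  have hdc : HasCompactSupport d := hcc.add (hφc.mul_left.add hφdc)
  have hXc : HasCompactSupport (fun x => φ x • x) := hφc.smul_right
  have hXcont : Continuous (fun x => φ x • x) := by fun_prop
  obtain ⟨Cd, hCd⟩ := hdc.exists_bound_of_continuous hdcont
  obtain ⟨CX, hCX⟩ := hXc.exists_bound_of_continuous hXcont
  have i1 : Integrable (fun p : EuclideanSpace ℝ (Fin n) × EuclideanSpace ℝ (Fin n) =>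
      g p.1 * g p.2 * regKernel μ η (p.1 - p.2) * d p.1) :=
    hGk.mul_bdd (c := Cd) (hdcont.comp continuous_fst).aestronglyMeasurable
      (.of_forall fun p => hCd _)
  have hqc : Continuous (fun p : EuclideanSpace ℝ (Fin n) × EuclideanSpace ℝ (Fin n) =>
      inner ℝ (p.1 - p.2) (φ p.1 • p.1) / (‖p.1 - p.2‖ ^ 2 + η)) := by
    refine Continuous.div (by fun_prop) (by fun_prop) fun p => ?_
    positivity
  have i2 : Integrable (fun p : EuclideanSpace ℝ (Fin n) × EuclideanSpace ℝ (Fin n) =>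
      g p.1 * g p.2 * regKernel μ η (p.1 - p.2) *
        (inner ℝ (p.1 - p.2) (φ p.1 • p.1) / (‖p.1 - p.2‖ ^ 2 + η))) := by
    refine hGk.mul_bdd (c := (1 + 1 / η) * CX) hqc.aestronglyMeasurable (.of_forall fun p => ?_)
    have hs : 0 < ‖p.1 - p.2‖ ^ 2 + η := by positivity
    rw [norm_div, Real.norm_of_nonneg hs.le, div_le_iff₀ hs]
    have h1 : ‖p.1 - p.2‖ ≤ (1 + 1 / η) * (‖p.1 - p.2‖ ^ 2 + η) := by
      have : (1 + 1 / η) * (‖p.1 - p.2‖ ^ 2 + η) =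
        ‖p.1 - p.2‖ ^ 2 + η + 1 + ‖p.1 - p.2‖ ^ 2 / η := by field_simp; ring
      rw [this]
      have : 0 ≤ ‖p.1 - p.2‖ ^ 2 / η := by positivity
      nlinarith [sq_nonneg (‖p.1 - p.2‖ - 1)]
    calc ‖inner ℝ (p.1 - p.2) (φ p.1 • p.1)‖ ≤ ‖p.1 - p.2‖ * ‖φ p.1 • p.1‖ := norm_inner_le_norm _ _
      _ ≤ ((1 + 1 / η) * (‖p.1 - p.2‖ ^ 2 + η)) * CX :=
        mul_le_mul h1 (hCX _) (norm_nonneg _) (by positivity)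
      _ = _ := by ring
  have i12 := i1.sub (i2.const_mul μ)
  have hzero : ∫ p : EuclideanSpace ℝ (Fin n) × EuclideanSpace ℝ (Fin n),
      (g p.1 * g p.2 * regKernel μ η (p.1 - p.2) * d p.1 -
        μ * (g p.1 * g p.2 * regKernel μ η (p.1 - p.2) *
        (inner ℝ (p.1 - p.2) (φ p.1 • p.1) / (‖p.1 - p.2‖ ^ 2 + η)))) = 0 := by
    rw [Measure.volume_eq_prod] at i12 ⊢
    refine (integral_prod_symm _ i12).trans (integral_eq_zero_of_ae (.of_forall fun y => ?_))
    have h := integral_mul_regKernel hη hg hφ hφc (μ := μ) y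
    have hkc : Continuous (fun x : EuclideanSpace ℝ (Fin n) => regKernel μ η (x - y)) := by fun_prop
    have hgcont := hg.continuous
    have hqy : Continuous (fun x : EuclideanSpace ℝ (Fin n) =>
        inner ℝ (x - y) (φ x • x) / (‖x - y‖ ^ 2 + η)) := by
      refine Continuous.div (by fun_prop) (by fun_prop) fun p => ?_
      positivity
    have hqyc : HasCompactSupport (fun x : EuclideanSpace ℝ (Fin n) =>
        inner ℝ (x - y) (φ x • x) / (‖x - y‖ ^ 2 + η)) := by
      refine hφc.mono fun x hx h => hx ?_
      simp [h]
    have j1 : Integrable (fun x => φ x * fderiv ℝ g x x * regKernel μ η (x - y)) := by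
      simp only [hgc]
      exact Continuous.integrable_of_hasCompactSupport (by fun_prop) (hcc.mul_left.mul_right)
    have j2 : Integrable (fun x => g x * regKernel μ η (x - y) * (n * φ x + fderiv ℝ φ x x -
        μ * (inner ℝ (x - y) (φ x • x) / (‖x - y‖ ^ 2 + η)))) := by
      refine Continuous.integrable_of_hasCompactSupport (by fun_prop)
        (HasCompactSupport.mul_left ?_)
      exact (hφc.mul_left.add hφdc).sub hqyc.mul_left
    have h2 : ∫ x, (φ x * fderiv ℝ g x x * regKernel μ η (x - y) +
        g x * regKernel μ η (x - y) * (n * φ x + fderiv ℝ φ x x -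
        μ * (inner ℝ (x - y) (φ x • x) / (‖x - y‖ ^ 2 + η)))) = 0 := by
      rw [integral_add j1 j2, h]
      ring
    have h3 := congrArg (fun r => g y * r) h2
    simp only [mul_zero] at h3
    rw [← integral_const_mul] at h3
    refine Eq.trans (integral_congr_ae (.of_forall fun x => ?_)) h3
    simp only [hgc, hd, Pi.sub_apply]
    ring
  rw [integral_sub i1 (i2.const_mul μ), integral_const_mul] at hzero
  have i2' := i2
  rw [Measure.volume_eq_prod] at i2'
  have hsymm := integral_eq_half_integral_add_swap i2'
  rw [← Measure.volume_eq_prod] at hsymm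
  have i3 : Integrable (fun p : EuclideanSpace ℝ (Fin n) × EuclideanSpace ℝ (Fin n) =>
      g p.1 * g p.2 * regKernel μ η (p.1 - p.2) *
        (inner ℝ (p.1 - p.2) (φ p.1 • p.1) / (‖p.1 - p.2‖ ^ 2 + η)) +
      (g p.2 * g p.1 * regKernel μ η (p.2 - p.1) *
        (inner ℝ (p.2 - p.1) (φ p.2 • p.2) / (‖p.2 - p.1‖ ^ 2 + η)))) := i2'.add i2'.swap
  simp only [Prod.fst_swap, Prod.snd_swap] at hsymm
  rw [hsymm] at hzero
  rw [← hzero, ← mul_assoc, ← integral_const_mul, ← integral_sub i1 (i3.const_mul _)]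
  congr 1 with p
  have e1 : regKernel μ η (p.2 - p.1) = regKernel μ η (p.1 - p.2) := by
    unfold regKernel
    rw [norm_sub_rev]
  rw [e1, norm_sub_rev p.2 p.1, ← neg_sub p.1 p.2, inner_neg_left, inner_sub_right]
  ring

/-- The difference quotient `⟪X x - X y, x - y⟫ / ‖x - y‖ ^ 2` of the field `X x = φ x • x`. -/
noncomputable def fieldQuotient {n : ℕ} (φ : EuclideanSpace ℝ (Fin n) → ℝ)
    (p : EuclideanSpace ℝ (Fin n) × EuclideanSpace ℝ (Fin n)) : ℝ :=
  inner ℝ (p.1 - p.2) (φ p.1 • p.1 - φ p.2 • p.2) / ‖p.1 - p.2‖ ^ 2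

lemma exists_norm_field_sub_le {n : ℕ} {φ : EuclideanSpace ℝ (Fin n) → ℝ} (hφ : ContDiff ℝ 1 φ)
    (hφc : HasCompactSupport φ) :
    ∃ L : ℝ, 0 ≤ L ∧ ∀ x y, ‖φ x • x - φ y • y‖ ≤ L * ‖x - y‖ := by
  obtain ⟨L, hL⟩ := ContDiff.lipschitzWith_of_hasCompactSupport (𝕂 := ℝ)
    (f := fun x => φ x • x) hφc.smul_right (hφ.smul contDiff_id) one_ne_zero
  refine ⟨L, L.2, fun x y => ?_⟩
  simpa [dist_eq_norm] using hL.dist_le_mul x y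

lemma abs_inner_div_add_le {F : Type*} [NormedAddCommGroup F] [InnerProductSpace ℝ F] {w h : F}
    {L η : ℝ} (hη : 0 ≤ η) (hL0 : 0 ≤ L) (hL : ‖h‖ ≤ L * ‖w‖) :
    |inner ℝ w h / (‖w‖ ^ 2 + η)| ≤ L := by
  have hs : 0 ≤ ‖w‖ ^ 2 + η := by positivity
  rw [abs_div, abs_of_nonneg hs]
  refine div_le_of_le_mul₀ hs hL0 ?_
  have h1 := abs_real_inner_le_norm w h
  have h2 := mul_le_mul_of_nonneg_left hL (norm_nonneg w)
  have h3 := mul_nonneg hL0 hη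
  nlinarith

lemma abs_fieldQuotient_le {n : ℕ} {φ : EuclideanSpace ℝ (Fin n) → ℝ} {L : ℝ} (hL0 : 0 ≤ L)
    (hL : ∀ x y, ‖φ x • x - φ y • y‖ ≤ L * ‖x - y‖)
    (p : EuclideanSpace ℝ (Fin n) × EuclideanSpace ℝ (Fin n)) : |fieldQuotient φ p| ≤ L := by
  have := abs_inner_div_add_le le_rfl hL0 (hL p.1 p.2)
  rwa [add_zero] at this

lemma measurable_fieldQuotient {n : ℕ} {φ : EuclideanSpace ℝ (Fin n) → ℝ} (hφ : Measurable φ) :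
    Measurable (fieldQuotient φ) := by
  unfold fieldQuotient
  fun_prop

lemma rpow_mul_regKernel {n : ℕ} {μ η : ℝ} (hη : 0 ≤ η) {w : EuclideanSpace ℝ (Fin n)}
    (hw : w ≠ 0) :
    ‖w‖ ^ μ * regKernel μ η w = ((‖w‖ ^ 2 + η) / ‖w‖ ^ 2) ^ (-μ / 2) := by
  have hw0 : 0 < ‖w‖ := norm_pos_iff.2 hw
  have h : (‖w‖ ^ 2) ^ (-μ / 2) = (‖w‖ ^ μ)⁻¹ := by
    rw [← Real.rpow_natCast, ← Real.rpow_mul hw0.le, ← Real.rpow_neg hw0.le]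
    congr 1
    push_cast
    ring
  rw [Real.div_rpow (by positivity) (by positivity), regKernel, h, div_inv_eq_mul, mul_comm]

/-- The weighted conformal Killing identity tested against the truncated dilation field. -/
lemma integral_double_identity {n : ℕ} (hn : 1 ≤ n) {μ : ℝ} (hμ : 0 < μ)
    {g φ c : EuclideanSpace ℝ (Fin n) → ℝ} (hg : ContDiff ℝ 1 g) (hgi : Integrable g)
    (hD : Integrable (fun p : EuclideanSpace ℝ (Fin n) × EuclideanSpace ℝ (Fin n) =>
      g p.1 * g p.2 / ‖p.1 - p.2‖ ^ μ))
    (hφ : ContDiff ℝ 1 φ) (hφc : HasCompactSupport φ)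
    (hc : Continuous c) (hcc : HasCompactSupport c)
    (hgc : ∀ x, φ x * fderiv ℝ g x x = g x * c x) :
    ∫ p : EuclideanSpace ℝ (Fin n) × EuclideanSpace ℝ (Fin n),
      g p.1 * g p.2 / ‖p.1 - p.2‖ ^ μ *
        (c p.1 + (n * φ p.1 + fderiv ℝ φ p.1 p.1) - μ / 2 * fieldQuotient φ p) = 0 := by
  have hφcont := hφ.continuous
  have hφd : Continuous (fun x => fderiv ℝ φ x x) :=
    (hφ.continuous_fderiv one_ne_zero).clm_apply continuous_id
  have hφdc : HasCompactSupport (fun x => fderiv ℝ φ x x) := by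
    refine (hφc.fderiv ℝ).mono fun x hx h => hx ?_
    simp [h]
  set d : EuclideanSpace ℝ (Fin n) → ℝ := fun x => c x + (n * φ x + fderiv ℝ φ x x) with hd
  have hdcont : Continuous d := by fun_prop
  have hdc : HasCompactSupport d := hcc.add (hφc.mul_left.add hφdc)
  obtain ⟨Cd, hCd⟩ := hdc.exists_bound_of_continuous hdcont
  obtain ⟨L, hL0, hL⟩ := exists_norm_field_sub_le hφ hφc
  let e : ℕ → ℝ := fun k => 1 / ((k : ℝ) + 1)
  have he : ∀ k, 0 < e k := fun k => by positivity
  have helim : Tendsto e atTop (𝓝 0) := tendsto_one_div_add_atTop_nhds_zero_nat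
  let ck : ℕ → EuclideanSpace ℝ (Fin n) × EuclideanSpace ℝ (Fin n) → ℝ := fun k p =>
    ‖p.1 - p.2‖ ^ μ * regKernel μ (e k) (p.1 - p.2) * (d p.1 - μ / 2 *
      (inner ℝ (p.1 - p.2) (φ p.1 • p.1 - φ p.2 • p.2) / (‖p.1 - p.2‖ ^ 2 + e k)))
  have hlim := tendsto_integral_mul_of_bdd hD (ck := ck) (C := Cd + μ / 2 * L)
    (c := fun p => d p.1 - μ / 2 * fieldQuotient φ p) ?_ ?_ ?_
  · refine tendsto_nhds_unique hlim ?_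
    refine tendsto_const_nhds.congr fun k => ?_
    rw [← integral_regKernel_identity hμ (he k) hg hgi hφ hφc hc hcc hgc]
    refine integral_congr_ae ?_
    filter_upwards [ae_prod_fst_ne_snd hn] with p hp
    have : ‖p.1 - p.2‖ ^ μ ≠ 0 := (Real.rpow_pos_of_pos (norm_pos_iff.2 hp) _).ne'
    simp only [ck, hd]
    field_simp
  · intro k
    have h1 := continuous_regKernel (n := n) (μ := μ) (he k)
    have h2 : Measurable (ck k) := by
      have := h1.measurable
      have := hdcont.measurable
      have := hφcont.measurable
      fun_prop
    exact h2.aestronglyMeasurable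
  · intro k
    filter_upwards [ae_prod_fst_ne_snd hn] with p hp
    have hw0 : 0 < ‖p.1 - p.2‖ := norm_pos_iff.2 hp
    have h0 : 0 ≤ ‖p.1 - p.2‖ ^ μ * regKernel μ (e k) (p.1 - p.2) :=
      mul_nonneg (by positivity) (regKernel_nonneg (he k) _)
    have h1 : ‖p.1 - p.2‖ ^ μ * regKernel μ (e k) (p.1 - p.2) ≤ 1 := by
      rw [rpow_mul_regKernel (he k).le hp]
      refine Real.rpow_le_one_of_one_le_of_nonpos ?_ (by linarith)
      rw [one_le_div (by positivity)]
      linarith [he k]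
    have h2 : |d p.1 - μ / 2 * (inner ℝ (p.1 - p.2) (φ p.1 • p.1 - φ p.2 • p.2) /
        (‖p.1 - p.2‖ ^ 2 + e k))| ≤ Cd + μ / 2 * L := by
      refine (abs_sub _ _).trans (add_le_add (hCd _) ?_)
      rw [abs_mul, abs_of_pos (by positivity : 0 < μ / 2)]
      exact mul_le_mul_of_nonneg_left (abs_inner_div_add_le (he k).le hL0 (hL _ _)) (by positivity)
    simp only [ck]
    rw [abs_mul, abs_of_nonneg h0]
    exact (mul_le_of_le_one_left (abs_nonneg _) h1).trans h2
  · filter_upwards [ae_prod_fst_ne_snd hn] with p hp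
    have hw0 : 0 < ‖p.1 - p.2‖ := norm_pos_iff.2 hp
    have hw2 : ‖p.1 - p.2‖ ^ 2 ≠ 0 := by positivity
    have hs : Tendsto (fun k => ‖p.1 - p.2‖ ^ 2 + e k) atTop (𝓝 (‖p.1 - p.2‖ ^ 2)) := by
      simpa using helim.const_add (‖p.1 - p.2‖ ^ 2)
    have h1 : Tendsto (fun k => ‖p.1 - p.2‖ ^ μ * regKernel μ (e k) (p.1 - p.2)) atTop (𝓝 1) := by
      have := (hs.div_const (‖p.1 - p.2‖ ^ 2)).rpow_const (p := -μ / 2)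
        (Or.inl (by rw [div_self hw2]; exact one_ne_zero))
      rw [div_self hw2, Real.one_rpow] at this
      exact this.congr fun k => (rpow_mul_regKernel (he k).le hp).symm
    have h2 := ((tendsto_const_nhds (x := inner ℝ (p.1 - p.2) (φ p.1 • p.1 - φ p.2 • p.2))).div
      hs hw2).const_mul (μ / 2)
    simpa [ck, fieldQuotient] using h1.mul (h2.const_sub (d p.1))

/-- The logarithmic potential identity tested against the truncated dilation field. -/
lemma IsLogPotential.integral_field {n : ℕ} (hn : 2 ≤ n) {β C : ℝ} (hβ : 0 < β)
    {f u φ : EuclideanSpace ℝ (Fin n) → ℝ}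
    (hf : Integrable f) (hb : BddOnBalls f) (hf0 : ∀ y, 0 ≤ f y) (hu : IsLogPotential β C f u)
    (hd : Differentiable ℝ u) (hφ : ContDiff ℝ 1 φ) (hφc : HasCompactSupport φ) :
    ∫ x, f x * (φ x * fderiv ℝ u x x) = -(1 / (2 * β)) *
      ∫ p : EuclideanSpace ℝ (Fin n) × EuclideanSpace ℝ (Fin n),
        f p.1 * f p.2 * fieldQuotient φ p := by
  have hφcont := hφ.continuous
  have hφm := hφcont.measurable
  set Q : EuclideanSpace ℝ (Fin n) × EuclideanSpace ℝ (Fin n) → ℝ := fun p =>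
    f p.1 * f p.2 * (inner ℝ (p.1 - p.2) (φ p.1 • p.1) / ‖p.1 - p.2‖ ^ 2) with hQ
  have hm : Measurable fun p : EuclideanSpace ℝ (Fin n) × EuclideanSpace ℝ (Fin n) =>
      inner ℝ (p.1 - p.2) (φ p.1 • p.1) / ‖p.1 - p.2‖ ^ 2 := by fun_prop
  have hQm : AEStronglyMeasurable Q (volume.prod volume) :=
    (hf.1.comp_fst.mul hf.1.comp_snd).mul hm.aestronglyMeasurable
  have hpt : ∀ x y, Q (x, y) = f x * (inner ℝ (x - y) (φ x • x) / ‖x - y‖ ^ 2 * f y) := by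
    intro x y
    simp only [hQ]
    ring
  have h1n : (1 : ℝ) < n := by exact_mod_cast (by omega : 1 < n)
  have hXc : HasCompactSupport (fun x => φ x • x) := hφc.smul_right
  obtain ⟨R, hR⟩ := hXc.isCompact.isBounded.exists_norm_le
  obtain ⟨CX, hCX⟩ := hXc.exists_bound_of_continuous (by fun_prop)
  have hCX0 : 0 ≤ CX := (norm_nonneg _).trans (hCX 0)
  obtain ⟨M, hM0, hM⟩ := exists_integral_abs_div_norm_sub_rpow_le (by omega) zero_le_one h1n hf hb R
  have hQi : Integrable Q (volume.prod volume) := by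
    refine (integrable_prod_iff hQm).2 ⟨.of_forall fun x => ?_, ?_⟩
    · simp only [hpt]
      exact (integrable_inner_div_mul hn hf hb x _).const_mul _
    · refine Integrable.mono' (hf.norm.mul_const (CX * M)) hQm.norm.integral_prod_right'
        (.of_forall fun x => ?_)
      rw [Real.norm_of_nonneg (integral_nonneg fun y => norm_nonneg _)]
      simp only [hpt, norm_mul]
      rw [integral_const_mul]
      refine mul_le_mul_of_nonneg_left ?_ (norm_nonneg _)
      by_cases hx : φ x • x = 0
      · simp only [hx, inner_zero_right, zero_div, norm_zero, zero_mul, integral_zero]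
        positivity
      · have hxR := hR x (subset_tsupport _ hx)
        have hi := (Integrable.div_norm_sub_rpow (by omega) zero_le_one h1n hf hb x).norm
        calc ∫ y, ‖inner ℝ (x - y) (φ x • x) / ‖x - y‖ ^ 2‖ * ‖f y‖
            ≤ ∫ y, CX * ‖f y / ‖x - y‖ ^ (1 : ℝ)‖ := by
              refine integral_mono_of_nonneg (.of_forall fun y => by positivity) (hi.const_mul _)
                (.of_forall fun y => ?_)
              have h1 := abs_inner_div_sq_le (x - y) (φ x • x)
              have h2 : ‖φ x • x‖ / ‖x - y‖ ≤ CX / ‖x - y‖ :=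
                div_le_div_of_nonneg_right (hCX x) (norm_nonneg _)
              refine (mul_le_mul_of_nonneg_right (h1.trans h2) (norm_nonneg _)).trans (le_of_eq ?_)
              simp only [Real.rpow_one, norm_div, norm_norm]
              ring
          _ ≤ CX * M := by
              rw [integral_const_mul]
              exact mul_le_mul_of_nonneg_left ((le_abs_self _).trans (hM x hxR)) hCX0
  have hfub : ∫ x, f x * (φ x * fderiv ℝ u x x) = -(1 / β) * ∫ p, Q p ∂(volume.prod volume) := by
    rw [integral_prod Q hQi, ← integral_const_mul]
    congr 1 with x
    simp only [hpt]
    rw [integral_const_mul, ← smul_eq_mul (φ x), ← map_smul, hu.fderiv_apply hn hβ hf hb hf0 (hd x)]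
    ring
  rw [hfub, integral_eq_half_integral_add_swap hQi, Measure.volume_eq_prod]
  have : ∀ p, Q p + Q p.swap = f p.1 * f p.2 * fieldQuotient φ p := by
    intro p
    simp only [hQ, Prod.fst_swap, Prod.snd_swap, fieldQuotient]
    rw [norm_sub_rev p.2 p.1, ← neg_sub p.1 p.2, inner_neg_left, inner_sub_right]
    ring
  simp only [this]
  ring

lemma integral_pos_of_ae_pos {n : ℕ} {f : EuclideanSpace ℝ (Fin n) → ℝ} (hf : Integrable f)
    (h : ∀ᵐ x, 0 < f x) : 0 < ∫ x, f x := by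
  rw [integral_pos_iff_support_of_nonneg_ae (h.mono fun x hx => hx.le) hf]
  have : volume (Function.support f) = volume (Set.univ : Set (EuclideanSpace ℝ (Fin n))) :=
    measure_congr (by filter_upwards [h] with x hx; exact eq_true hx.ne')
  rw [this]
  exact Measure.measure_univ_pos.2 (NeZero.ne _)

/-- A solution of the integral equation has total curvature exactly `2 β`. -/
lemma IsLogPotential.integral_eq_two_mul {n : ℕ} (hn : 2 ≤ n) {μ β C : ℝ} (hμ : 0 < μ) (hμn : μ < n)
    (hβ : 0 < β) {u g f : EuclideanSpace ℝ (Fin n) → ℝ} (hu : ContDiff ℝ 1 u)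
    (hg : g = fun x => Real.exp ((2 * n - μ) / 2 * u x))
    (hgi : Integrable g)
    (hD : Integrable (fun p : EuclideanSpace ℝ (Fin n) × EuclideanSpace ℝ (Fin n) =>
      g p.1 * g p.2 / ‖p.1 - p.2‖ ^ μ))
    (hfg : f = fun x => (∫ y, g y / ‖x - y‖ ^ μ) * g x)
    (hf : Integrable f) (hb : BddOnBalls f) (hpos : ∀ x, 0 < f x) (hlog : IsLogPotential β C f u) :
    ∫ x, f x = 2 * β := by
  set a : ℝ := (2 * n - μ) / 2 with ha
  have ha0 : 0 < a := by rw [ha]; linarith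
  have hgC : ContDiff ℝ 1 g := by
    rw [hg]
    exact (contDiff_const.mul hu).exp
  have hgd : ∀ x h, fderiv ℝ g x h = g x * (a * fderiv ℝ u x h) := by
    intro x h
    have h1 := (((hu.differentiable one_ne_zero x).hasFDerivAt).const_mul a).exp
    rw [hg, h1.fderiv]
    simp
  have hud : Continuous (fun x => fderiv ℝ u x x) :=
    (hu.continuous_fderiv one_ne_zero).clm_apply continuous_id
  have hn1 : 1 ≤ n := by omega
  set T := ∫ x, f x with hT
  have hTpos : 0 < T := integral_pos_of_ae_pos hf (.of_forall hpos)
  set D : EuclideanSpace ℝ (Fin n) × EuclideanSpace ℝ (Fin n) → ℝ := fun p =>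
    g p.1 * g p.2 / ‖p.1 - p.2‖ ^ μ with hDdef
  have hDin : ∀ c : EuclideanSpace ℝ (Fin n) → ℝ, ∀ x, ∫ y, D (x, y) * c x = f x * c x := by
    intro c x
    rw [integral_mul_const, hfg]
    congr 1
    change _ = (∫ y, g y / ‖x - y‖ ^ μ) * g x
    rw [mul_comm _ (g x), ← integral_const_mul]
    congr 1 with y
    exact mul_div_assoc _ _ _
  have hDT : ∫ p, D p = T := by
    have hD' := hD
    rw [Measure.volume_eq_prod] at hD' ⊢
    rw [integral_prod _ hD', hT]
    congr 1 with x
    simpa using hDin (fun _ => 1) x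
  have hff : Integrable (fun p : EuclideanSpace ℝ (Fin n) × EuclideanSpace ℝ (Fin n) =>
    f p.1 * f p.2) := hf.mul_prod hf
  have hffT : ∫ p : EuclideanSpace ℝ (Fin n) × EuclideanSpace ℝ (Fin n), f p.1 * f p.2 = T * T := by
    rw [Measure.volume_eq_prod, integral_prod_mul]
  have hmain : ∀ φ : EuclideanSpace ℝ (Fin n) → ℝ, ContDiff ℝ 1 φ → HasCompactSupport φ →
      -(a / (2 * β)) * (∫ p : EuclideanSpace ℝ (Fin n) × EuclideanSpace ℝ (Fin n),
        f p.1 * f p.2 * fieldQuotient φ p) +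
      ∫ p, D p * ((n * φ p.1 + fderiv ℝ φ p.1 p.1) - μ / 2 * fieldQuotient φ p) = 0 := by
    intro φ hφ hφc
    have hφcont := hφ.continuous
    have hφd : Continuous (fun x => fderiv ℝ φ x x) :=
      (hφ.continuous_fderiv one_ne_zero).clm_apply continuous_id
    have hφdc : HasCompactSupport (fun x => fderiv ℝ φ x x) := by
      refine (hφc.fderiv ℝ).mono fun x hx h => hx ?_
      simp [h]
    set c : EuclideanSpace ℝ (Fin n) → ℝ := fun x => a * (φ x * fderiv ℝ u x x) with hc
    have hccont : Continuous c := by fun_prop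
    have hcc : HasCompactSupport c := hφc.mul_right.mul_left
    have h1 := integral_double_identity hn1 hμ hgC hgi hD hφ hφc hccont hcc
      (fun x => by rw [hgd, hc]; ring)
    have h2 := hlog.integral_field hn hβ hf hb (fun y => (hpos y).le)
      (hu.differentiable one_ne_zero) hφ hφc
    obtain ⟨Cc, hCc⟩ := hcc.exists_bound_of_continuous hccont
    obtain ⟨Cd, hCd⟩ := (hφc.mul_left.add hφdc :
      HasCompactSupport ((fun x => (n : ℝ) * φ x) + fun x => fderiv ℝ φ x x)).exists_bound_of_continuous
        (by fun_prop)
    obtain ⟨L, hL0, hL⟩ := exists_norm_field_sub_le hφ hφc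
    have i1 : Integrable (fun p => D p * c p.1) :=
      hD.mul_bdd (c := Cc) (hccont.comp continuous_fst).aestronglyMeasurable
        (.of_forall fun p => hCc _)
    have i2 : Integrable (fun p => D p *
        ((n * φ p.1 + fderiv ℝ φ p.1 p.1) - μ / 2 * fieldQuotient φ p)) := by
      refine hD.mul_bdd (c := Cd + μ / 2 * L) ?_ (.of_forall fun p => ?_)
      · have := measurable_fieldQuotient hφcont.measurable
        have := hφcont.measurable
        have := hφd.measurable
        exact Measurable.aestronglyMeasurable (by fun_prop)
      · refine (abs_sub _ _).trans (add_le_add (hCd p.1) ?_)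
        rw [abs_mul, abs_of_pos (by positivity : 0 < μ / 2)]
        exact mul_le_mul_of_nonneg_left (abs_fieldQuotient_le hL0 hL p) (by positivity)
    have h3 : ∫ p, D p * c p.1 = a * ∫ x, f x * (φ x * fderiv ℝ u x x) := by
      rw [Measure.volume_eq_prod] at i1 ⊢
      rw [integral_prod _ i1, ← integral_const_mul]
      congr 1 with x
      refine (hDin c x).trans ?_
      rw [hc]
      ring
    have h4 : (∫ p, D p * c p.1) + (∫ p, D p *
        ((n * φ p.1 + fderiv ℝ φ p.1 p.1) - μ / 2 * fieldQuotient φ p)) = 0 := by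
      rw [← integral_add i1 i2, ← h1]
      congr 1 with p
      ring
    rw [h3, h2] at h4
    rw [← h4]
    ring
  let b : ContDiffBump (0 : EuclideanSpace ℝ (Fin n)) := ⟨1, 2, one_pos, one_lt_two⟩
  have hbC : ContDiff ℝ 1 b := b.contDiff
  have hbc : HasCompactSupport b := b.hasCompactSupport
  have hb0 : b 0 = 1 := b.one_of_mem_closedBall (by simp [b.rIn_pos.le])
  have hbd : Continuous (fun x => fderiv ℝ b x x) :=
    (hbC.continuous_fderiv one_ne_zero).clm_apply continuous_id
  have hbdc : HasCompactSupport (fun x => fderiv ℝ b x x) := by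
    refine (hbc.fderiv ℝ).mono fun x hx h => hx ?_
    simp [h]
  have hbcont : Continuous b := hbC.continuous
  obtain ⟨Cd, hCd⟩ := (hbc.mul_left.add hbdc :
    HasCompactSupport ((fun x => (n : ℝ) * b x) + fun x => fderiv ℝ b x x)).exists_bound_of_continuous
      (by fun_prop)
  obtain ⟨L, hL0, hL⟩ := exists_norm_field_sub_le hbC hbc
  let e : ℕ → ℝ := fun k => 1 / ((k : ℝ) + 1)
  have he : ∀ k, 0 < e k := fun k => by positivity
  have helim : Tendsto e atTop (𝓝 0) := tendsto_one_div_add_atTop_nhds_zero_nat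
  let φ : ℕ → EuclideanSpace ℝ (Fin n) → ℝ := fun k x => b (e k • x)
  have hφC : ∀ k, ContDiff ℝ 1 (φ k) := fun k => hbC.comp (contDiff_const_smul (e k))
  have hφc : ∀ k, HasCompactSupport (φ k) := fun k => hbc.comp_smul (he k).ne'
  have hφd : ∀ k x, fderiv ℝ (φ k) x x = fderiv ℝ b (e k • x) (e k • x) := by
    intro k x
    have h1 : HasFDerivAt (fun x : EuclideanSpace ℝ (Fin n) => e k • x)
        (e k • ContinuousLinearMap.id ℝ (EuclideanSpace ℝ (Fin n))) x :=
      (hasFDerivAt_id x).const_smul (e k)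
    have h2 := ((hbC.differentiable one_ne_zero (e k • x)).hasFDerivAt).comp x h1
    have h3 : fderiv ℝ (φ k) x = _ := h2.fderiv
    rw [h3]
    simp
  have hφL : ∀ k x y, ‖φ k x • x - φ k y • y‖ ≤ L * ‖x - y‖ := by
    intro k x y
    have h := hL (e k • x) (e k • y)
    rw [smul_comm, smul_comm _ (e k) y, ← smul_sub, ← smul_sub, norm_smul, norm_smul,
      Real.norm_of_nonneg (he k).le, mul_left_comm] at h
    exact le_of_mul_le_mul_left h (he k)
  have hq : ∀ᵐ p : EuclideanSpace ℝ (Fin n) × EuclideanSpace ℝ (Fin n),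
      Tendsto (fun k => fieldQuotient (φ k) p) atTop (𝓝 1) := by
    filter_upwards [ae_prod_fst_ne_snd hn1] with p hp
    have hw0 : 0 < ‖p.1 - p.2‖ := norm_pos_iff.2 hp
    have hF : Continuous (fun t : ℝ =>
        inner ℝ (p.1 - p.2) (b (t • p.1) • p.1 - b (t • p.2) • p.2) / ‖p.1 - p.2‖ ^ 2) := by
      fun_prop
    have := (hF.tendsto 0).comp helim
    simp only [zero_smul, hb0, one_smul, real_inner_self_eq_norm_sq] at this
    rwa [div_self (by positivity)] at this
  have l1 := tendsto_integral_mul_of_bdd hff (ck := fun k => fieldQuotient (φ k)) (C := L)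
    (c := fun _ => 1)
    (fun k => (measurable_fieldQuotient (hφC k).continuous.measurable).aestronglyMeasurable)
    (fun k => .of_forall fun p => abs_fieldQuotient_le hL0 (hφL k) p) hq
  have l2 := tendsto_integral_mul_of_bdd hD (C := Cd + μ / 2 * L) (c := fun _ => n - μ / 2)
    (ck := fun k p => (n * φ k p.1 + fderiv ℝ (φ k) p.1 p.1) - μ / 2 * fieldQuotient (φ k) p)
    ?_ ?_ ?_
  · have l3 := (l1.const_mul (-(a / (2 * β)))).add l2
    have h0 := tendsto_nhds_unique l3
      (tendsto_const_nhds.congr fun k => (hmain (φ k) (hφC k) (hφc k)).symm)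
    simp only [mul_one] at h0
    rw [integral_mul_const, hDT, hffT] at h0
    have h1 : a * T * (2 * β - T) = 0 := by
      have : (n : ℝ) - μ / 2 = a := by rw [ha]; ring
      rw [this] at h0
      field_simp at h0
      linarith
    have := (mul_eq_zero.1 h1).resolve_left (by positivity)
    linarith
  · intro k
    have := measurable_fieldQuotient (hφC k).continuous.measurable
    have := (hφC k).continuous.measurable
    have := hbd.measurable
    simp only [hφd]
    exact Measurable.aestronglyMeasurable (by fun_prop)
  · intro k
    refine .of_forall fun p => (abs_sub _ _).trans (add_le_add ?_ ?_)
    · rw [hφd]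
      exact hCd (e k • p.1)
    · rw [abs_mul, abs_of_pos (by positivity : 0 < μ / 2)]
      exact mul_le_mul_of_nonneg_left (abs_fieldQuotient_le hL0 (hφL k) p) (by positivity)
  · filter_upwards [hq] with p hp
    have hF : Continuous (fun t : ℝ => n * b (t • p.1) + fderiv ℝ b (t • p.1) (t • p.1)) := by
      have : Continuous (fun t : ℝ => fderiv ℝ b (t • p.1) (t • p.1)) :=
        hbd.comp (continuous_id.smul continuous_const)
      fun_prop
    have h1 := (hF.tendsto 0).comp helim
    simp only [zero_smul, hb0, map_zero, mul_one, add_zero] at h1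
    have h2 := h1.sub (hp.const_mul (μ / 2))
    rw [mul_one] at h2
    refine h2.congr fun k => ?_
    simp only [hφd, Function.comp_apply, φ]

lemma norm_inversion_sub_le {F : Type*} [NormedAddCommGroup F] [NormedSpace ℝ F] {x : F} {l : ℝ}
    (hx : 0 < ‖x‖) (hxl : ‖x‖ < l) :
    ‖(‖x‖ ^ 2)⁻¹ • x - (l ^ 2)⁻¹ • x‖ ≤ 2 / ‖x‖ * Real.log (l / ‖x‖) := by
  have hl : 0 < l := hx.trans hxl
  have h1 := Real.one_sub_inv_le_log_of_pos (show 0 < (l / ‖x‖) ^ 2 by positivity)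
  rw [Real.log_pow] at h1
  have h2 : 0 ≤ (‖x‖ ^ 2)⁻¹ - (l ^ 2)⁻¹ := sub_nonneg.2 (by gcongr)
  rw [← sub_smul, norm_smul, Real.norm_of_nonneg h2]
  have h3 : ((‖x‖ ^ 2)⁻¹ - (l ^ 2)⁻¹) * ‖x‖ = 1 / ‖x‖ * (1 - ((l / ‖x‖) ^ 2)⁻¹) := by
    field_simp
  rw [h3]
  calc 1 / ‖x‖ * (1 - ((l / ‖x‖) ^ 2)⁻¹) ≤ 1 / ‖x‖ * ((2 : ℕ) * Real.log (l / ‖x‖)) := by gcongr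
    _ = _ := by push_cast; ring

lemma norm_inv_sq_smul_self {F : Type*} [NormedAddCommGroup F] [NormedSpace ℝ F] {x : F}
    (hx : 0 < ‖x‖) : ‖(‖x‖ ^ 2)⁻¹ • x‖ = 1 / ‖x‖ := by
  rw [norm_smul, Real.norm_of_nonneg (by positivity)]
  field_simp

lemma norm_inv_sq_smul_le {F : Type*} [NormedAddCommGroup F] [NormedSpace ℝ F] {x : F} {l : ℝ}
    (hl : 0 < l) (hxl : ‖x‖ < l) : ‖(l ^ 2)⁻¹ • x‖ ≤ 1 / l := by
  rw [norm_smul, Real.norm_of_nonneg (by positivity), inv_mul_le_iff₀ (by positivity)]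
  have : l ^ 2 * (1 / l) = l := by field_simp
  rw [this]
  exact hxl.le

lemma exists_lipschitz_closedBall {F : Type*} [NormedAddCommGroup F] [NormedSpace ℝ F]
    [FiniteDimensional ℝ F] {u : F → ℝ} (hu : ContDiff ℝ 1 u) (R : ℝ) :
    ∃ L : ℝ, 0 ≤ L ∧ ∀ p q, ‖p‖ ≤ R → ‖q‖ ≤ R → |u p - u q| ≤ L * ‖p - q‖ := by
  have : ProperSpace F := FiniteDimensional.proper ℝ F
  obtain ⟨L, hL⟩ := (isCompact_closedBall (0 : F) R).exists_bound_of_continuousOn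
    (hu.continuous_fderiv one_ne_zero).continuousOn
  refine ⟨max L 0, le_max_right _ _, fun p q hp hq => ?_⟩
  exact (convex_closedBall (0 : F) R).norm_image_sub_le_of_norm_fderiv_le
    (fun x _ => hu.differentiable one_ne_zero x) (fun x hx => (hL x hx).trans (le_max_left _ _))
    (by simpa using hq) (by simpa using hp)

/-- A function which is Lipschitz near the origin and decays no faster than `-2 log ‖y‖`
dominates its Kelvin-type reflection for large radii. -/
lemma exists_forall_log_reflection_nonneg {F : Type*} [NormedAddCommGroup F] [NormedSpace ℝ F]
    {u : F → ℝ} {C L : ℝ}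
    (hC : ∀ y, -(2 * Real.log (‖y‖ + 1)) + C ≤ u y) (hL0 : 0 ≤ L)
    (hL : ∀ p q, ‖p‖ ≤ 1 / 2 → ‖q‖ ≤ 1 / 2 → |u p - u q| ≤ L * ‖p - q‖) :
    ∃ l₀ > (0 : ℝ), ∀ l : ℝ, l₀ ≤ l → ∀ x : F, 0 < ‖x‖ → ‖x‖ < l →
      0 ≤ u ((‖x‖ ^ 2)⁻¹ • x) - 2 * Real.log ‖x‖ - u ((l ^ 2)⁻¹ • x) + 2 * Real.log l := by
  set r := L + 2 with hr
  obtain ⟨A, hA⟩ := (Real.tendsto_log_atTop.eventually_ge_atTop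
    ((u 0 + L * (1 / 2) - C + 2 * Real.log (1 + r)) / 2)).exists_forall_of_atTop
  refine ⟨max A 2, by positivity, fun l hl x hx hxl => ?_⟩
  have hl2 : 2 ≤ l := (le_max_right _ _).trans hl
  have hl0 : 0 < l := by linarith
  have hq : ‖(l ^ 2)⁻¹ • x‖ ≤ 1 / 2 :=
    (norm_inv_sq_smul_le hl0 hxl).trans (one_div_le_one_div_of_le two_pos hl2)
  have hp := norm_inv_sq_smul_self hx
  rcases le_total r ‖x‖ with h | h
  · have h1 := hL ((‖x‖ ^ 2)⁻¹ • x) ((l ^ 2)⁻¹ • x)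
      (by rw [hp]; exact one_div_le_one_div_of_le two_pos (by linarith)) hq
    have h2 := mul_le_mul_of_nonneg_left (norm_inversion_sub_le hx hxl) hL0
    have hlog : 0 ≤ Real.log (l / ‖x‖) := Real.log_nonneg ((one_le_div hx).2 hxl.le)
    have h3 : L * (2 / ‖x‖ * Real.log (l / ‖x‖)) ≤ 2 * Real.log (l / ‖x‖) := by
      have : L / ‖x‖ ≤ 1 := (div_le_one hx).2 (by linarith)
      calc L * (2 / ‖x‖ * Real.log (l / ‖x‖)) = 2 * (L / ‖x‖) * Real.log (l / ‖x‖) := by ring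
        _ ≤ 2 * 1 * Real.log (l / ‖x‖) := by gcongr
        _ = _ := by ring
    rw [Real.log_div hl0.ne' hx.ne'] at h2 h3
    linarith [neg_abs_le (u ((‖x‖ ^ 2)⁻¹ • x) - u ((l ^ 2)⁻¹ • x))]
  · have h1 := hL ((l ^ 2)⁻¹ • x) 0 hq (by simp)
    rw [sub_zero] at h1
    have h2 := (le_abs_self _).trans h1
    have h3 : L * ‖(l ^ 2)⁻¹ • x‖ ≤ L * (1 / 2) := by gcongr
    have h4 := hA l ((le_max_left _ _).trans hl)
    have h5 := hC ((‖x‖ ^ 2)⁻¹ • x)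
    rw [hp] at h5
    have h6 : Real.log (1 / ‖x‖ + 1) + Real.log ‖x‖ = Real.log (1 + ‖x‖) := by
      rw [← Real.log_mul (by positivity) hx.ne']
      congr 1
      field_simp
    have h7 : Real.log (1 + ‖x‖) ≤ Real.log (1 + r) := Real.log_le_log (by positivity) (by linarith)
    linarith

/-- A function which is Lipschitz near the origin and decays no faster than `‖y‖ ^ (-μ)`
dominates its Kelvin transform for large radii. -/
lemma exists_forall_rpow_reflection_nonneg {F : Type*} [NormedAddCommGroup F] [NormedSpace ℝ F]
    {v : F → ℝ} {μ c L : ℝ} (hμ : 0 < μ) (hc0 : 0 < c)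
    (hc : ∀ y, c / (‖y‖ + 1) ^ μ ≤ v y) (hL0 : 0 ≤ L)
    (hL : ∀ p q, ‖p‖ ≤ 1 / 2 → ‖q‖ ≤ 1 / 2 → |v p - v q| ≤ L * ‖p - q‖) :
    ∃ l₀ > (0 : ℝ), ∀ l : ℝ, l₀ ≤ l → ∀ x : F, 0 < ‖x‖ → ‖x‖ < l →
      0 ≤ ‖x‖ ^ (-μ) * v ((‖x‖ ^ 2)⁻¹ • x) - l ^ (-μ) * v ((l ^ 2)⁻¹ • x) := by
  set m := c / 2 ^ μ with hm
  have hm0 : 0 < m := by positivity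
  set r := 2 * L / (μ * m) + 2 with hr
  have hr0 : 0 < r := by positivity
  obtain ⟨A, hA⟩ := (((tendsto_rpow_neg_atTop hμ).mul_const (v 0 + L * (1 / 2))).eventually_le_const
    (show 0 * (v 0 + L * (1 / 2)) < c / (1 + r) ^ μ by rw [zero_mul]; positivity)
    ).exists_forall_of_atTop
  refine ⟨max A 2, by positivity, fun l hl x hx hxl => ?_⟩
  have hl2 : 2 ≤ l := (le_max_right _ _).trans hl
  have hl0 : 0 < l := by linarith
  have hq : ‖(l ^ 2)⁻¹ • x‖ ≤ 1 / 2 :=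
    (norm_inv_sq_smul_le hl0 hxl).trans (one_div_le_one_div_of_le two_pos hl2)
  have hp := norm_inv_sq_smul_self hx
  rcases le_total r ‖x‖ with h | h
  · have hx2 : 2 ≤ ‖x‖ := le_trans (by rw [hr]; linarith [show 0 ≤ 2 * L / (μ * m) by positivity]) h
    have hp2 : ‖(‖x‖ ^ 2)⁻¹ • x‖ ≤ 1 / 2 := by rw [hp]; exact one_div_le_one_div_of_le two_pos hx2
    have h1 := hL ((‖x‖ ^ 2)⁻¹ • x) ((l ^ 2)⁻¹ • x) hp2 hq
    have h2 := mul_le_mul_of_nonneg_left (norm_inversion_sub_le hx hxl) hL0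
    have hlog : 0 ≤ Real.log (l / ‖x‖) := Real.log_nonneg ((one_le_div hx).2 hxl.le)
    have hmv : m ≤ v ((‖x‖ ^ 2)⁻¹ • x) := by
      refine le_trans ?_ (hc _)
      rw [hm]
      gcongr
      linarith
    have h3 : L * (2 / ‖x‖ * Real.log (l / ‖x‖)) ≤ μ * m * Real.log (l / ‖x‖) := by
      have : 2 * L / ‖x‖ ≤ μ * m := by
        rw [div_le_iff₀ hx, ← div_le_iff₀' (by positivity)]
        linarith
      calc L * (2 / ‖x‖ * Real.log (l / ‖x‖)) = (2 * L / ‖x‖) * Real.log (l / ‖x‖) := by ring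
        _ ≤ _ := by gcongr
    have h4 : 1 + μ * Real.log (l / ‖x‖) ≤ (l / ‖x‖) ^ μ := by
      rw [Real.rpow_def_of_pos (by positivity)]
      linarith [Real.add_one_le_exp (Real.log (l / ‖x‖) * μ)]
    have h5 : ‖x‖ ^ (-μ) = l ^ (-μ) * (l / ‖x‖) ^ μ := by
      rw [Real.div_rpow hl0.le hx.le, Real.rpow_neg hx.le, Real.rpow_neg hl0.le]
      field_simp
    rw [h5, mul_assoc, ← mul_sub]
    refine mul_nonneg (by positivity) ?_
    have h6 : (1 + μ * Real.log (l / ‖x‖)) * v ((‖x‖ ^ 2)⁻¹ • x) ≤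
        (l / ‖x‖) ^ μ * v ((‖x‖ ^ 2)⁻¹ • x) := by
      gcongr
      linarith
    have h7 : μ * Real.log (l / ‖x‖) * m ≤ μ * Real.log (l / ‖x‖) * v ((‖x‖ ^ 2)⁻¹ • x) := by gcongr
    linarith [neg_abs_le (v ((‖x‖ ^ 2)⁻¹ • x) - v ((l ^ 2)⁻¹ • x))]
  · have h1 := hL ((l ^ 2)⁻¹ • x) 0 hq (by simp)
    rw [sub_zero] at h1
    have h2 := (le_abs_self _).trans h1
    have h3 : L * ‖(l ^ 2)⁻¹ • x‖ ≤ L * (1 / 2) := by gcongr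
    have h4 := hA l ((le_max_left _ _).trans hl)
    have h5 : l ^ (-μ) * v ((l ^ 2)⁻¹ • x) ≤ l ^ (-μ) * (v 0 + L * (1 / 2)) := by
      gcongr
      linarith
    have h6 : c / (1 + r) ^ μ ≤ ‖x‖ ^ (-μ) * v ((‖x‖ ^ 2)⁻¹ • x) := by
      calc c / (1 + r) ^ μ ≤ c / (1 + ‖x‖) ^ μ := by gcongr
        _ = ‖x‖ ^ (-μ) * (c / (1 / ‖x‖ + 1) ^ μ) := by
          have : 1 / ‖x‖ + 1 = (1 + ‖x‖) / ‖x‖ := by field_simp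
          rw [this, Real.div_rpow (by positivity) hx.le, Real.rpow_neg hx.le]
          field_simp
        _ ≤ _ := by
          have := hc ((‖x‖ ^ 2)⁻¹ • x)
          rw [hp] at this
          gcongr
    linarith

lemma abs_rpow_neg_sub_le {μ a b : ℝ} (hμ : 0 < μ) (ha : 1 / 2 ≤ a) (hb : 1 / 2 ≤ b) :
    |a ^ (-μ) - b ^ (-μ)| ≤ μ * (1 / 2) ^ (-μ - 1) * |a - b| := by
  refine (convex_Ici (1 / 2 : ℝ)).norm_image_sub_le_of_norm_hasDerivWithin_le
    (f := fun t : ℝ => t ^ (-μ)) (f' := fun t => -μ * t ^ (-μ - 1))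
    (fun t ht => ?_) (fun t ht => ?_) hb ha
  · have ht0 : 0 < t := lt_of_lt_of_le one_half_pos ht
    exact (Real.hasDerivAt_rpow_const (Or.inl ht0.ne')).hasDerivWithinAt
  · have ht0 : 0 < t := lt_of_lt_of_le one_half_pos ht
    rw [norm_mul, norm_neg, Real.norm_of_nonneg hμ.le, Real.norm_of_nonneg (by positivity)]
    exact mul_le_mul_of_nonneg_left
      (Real.rpow_le_rpow_of_nonpos one_half_pos ht (by linarith)) hμ.le

lemma locallyIntegrable_norm_rpow_neg {n : ℕ} (hn : 1 ≤ n) {p : ℝ} (hp : 0 ≤ p) (hpn : p < n) :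
    LocallyIntegrable (fun w : EuclideanSpace ℝ (Fin n) => ‖w‖ ^ (-p)) := by
  refine LocallyIntegrable.mono
    ((integrable_nearKernel hn hpn).locallyIntegrable.add (locallyIntegrable_const (1 : ℝ)))
    (Measurable.aestronglyMeasurable (by fun_prop)) (.of_forall fun w => ?_)
  have h0 := nearKernel_nonneg p w
  simp only [Pi.add_apply]
  rw [Real.norm_of_nonneg (by positivity), Real.norm_of_nonneg (by positivity)]
  by_cases h : ‖w‖ < 1
  · have : nearKernel n p w = ‖w‖ ^ (-p) := Set.indicator_of_mem (by simpa using h) _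
    linarith
  · have := Real.rpow_le_one_of_one_le_of_nonpos (not_lt.1 h) (neg_nonpos.2 hp)
    linarith

lemma contDiff_integral_div {n : ℕ} (hn : 1 ≤ n) {p : ℝ} (hp : 0 ≤ p) (hpn : p < n)
    {g : EuclideanSpace ℝ (Fin n) → ℝ} (hg : ContDiff ℝ 1 g) (hc : HasCompactSupport g) :
    ContDiff ℝ 1 (fun x => ∫ y, g y / ‖x - y‖ ^ p) := by
  have h := hc.contDiff_convolution_right (n := 1) (ContinuousLinearMap.mul ℝ ℝ) (μ := volume)
    (locallyIntegrable_norm_rpow_neg hn hp hpn) hg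
  refine (congrArg (ContDiff ℝ 1) (funext fun x => ?_)).mpr h
  rw [MeasureTheory.convolution, ← integral_sub_left_eq_self _ volume x]
  congr 1 with y
  rw [sub_sub_cancel, ContinuousLinearMap.mul_apply', Real.rpow_neg (norm_nonneg _), mul_comm,
    div_eq_mul_inv]

lemma exists_lipschitz_integral_div {n : ℕ} (hn : 1 ≤ n) {p : ℝ} (hp : 0 < p) (hpn : p < n)
    {g : EuclideanSpace ℝ (Fin n) → ℝ} (hg : ContDiff ℝ 1 g) (hgi : Integrable g) :
    ∃ L : ℝ, 0 ≤ L ∧ ∀ x z : EuclideanSpace ℝ (Fin n), ‖x‖ ≤ 1 / 2 → ‖z‖ ≤ 1 / 2 →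
      |(∫ y, g y / ‖x - y‖ ^ p) - ∫ y, g y / ‖z - y‖ ^ p| ≤ L * ‖x - z‖ := by
  let b : ContDiffBump (0 : EuclideanSpace ℝ (Fin n)) := ⟨1, 2, one_pos, one_lt_two⟩
  have hbC : ContDiff ℝ 1 b := b.contDiff
  set g₁ : EuclideanSpace ℝ (Fin n) → ℝ := fun y => b y * g y with hg₁
  set g₂ : EuclideanSpace ℝ (Fin n) → ℝ := fun y => g y - g₁ y with hg₂
  have hg₁C : ContDiff ℝ 1 g₁ := hbC.mul hg
  have hg₁c : HasCompactSupport g₁ := b.hasCompactSupport.mul_right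
  have hg₁i : Integrable g₁ := hg₁C.continuous.integrable_of_hasCompactSupport hg₁c
  have hg₂i : Integrable g₂ := hgi.sub hg₁i
  have hg₂C : Continuous g₂ := hg.continuous.sub hg₁C.continuous
  have hg₂0 : ∀ y, ‖y‖ ≤ 1 → g₂ y = 0 := by
    intro y hy
    have : b y = 1 := b.one_of_mem_closedBall (by simpa [b] using hy)
    simp [hg₂, hg₁, this]
  obtain ⟨L, hL0, hL⟩ := exists_lipschitz_closedBall (contDiff_integral_div hn hp.le hpn
    hg₁C hg₁c) (1 / 2)
  set K := p * (1 / 2 : ℝ) ^ (-p - 1) with hK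
  have hG := integral_nonneg (μ := volume) (f := fun y => ‖g₂ y‖) (fun y => norm_nonneg (g₂ y))
  have i₁ := Integrable.div_norm_sub_rpow hn hp.le hpn hg₁i hg₁C.continuous.bddOnBalls
  have i₂ := Integrable.div_norm_sub_rpow hn hp.le hpn hg₂i hg₂C.bddOnBalls
  have hsplit : ∀ x, ∫ y, g y / ‖x - y‖ ^ p =
      (∫ y, g₁ y / ‖x - y‖ ^ p) + ∫ y, g₂ y / ‖x - y‖ ^ p := by
    intro x
    rw [← integral_add (i₁ x) (i₂ x)]
    congr 1 with y
    rw [← add_div, hg₂, add_sub_cancel]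
  refine ⟨L + K * ∫ y, ‖g₂ y‖, by positivity, fun x z hx hz => ?_⟩
  have h2 : |(∫ y, g₂ y / ‖x - y‖ ^ p) - ∫ y, g₂ y / ‖z - y‖ ^ p| ≤
      (K * ∫ y, ‖g₂ y‖) * ‖x - z‖ := by
    rw [← integral_sub (i₂ x) (i₂ z)]
    have : (K * ∫ y, ‖g₂ y‖) * ‖x - z‖ = ∫ y, (K * ‖x - z‖) * ‖g₂ y‖ := by
      rw [integral_const_mul]
      ring
    rw [this]
    rw [← Real.norm_eq_abs]
    refine norm_integral_le_of_norm_le (hg₂i.norm.const_mul _) (.of_forall fun y => ?_)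
    by_cases hy : ‖y‖ ≤ 1
    · simp [hg₂0 y hy]
    have hyx : 1 / 2 ≤ ‖x - y‖ := by linarith [norm_sub_norm_le y x, norm_sub_rev x y]
    have hyz : 1 / 2 ≤ ‖z - y‖ := by linarith [norm_sub_norm_le y z, norm_sub_rev z y]
    have h3 := abs_rpow_neg_sub_le hp hyx hyz
    have h4 := abs_norm_sub_norm_le (x - y) (z - y)
    rw [sub_sub_sub_cancel_right] at h4
    rw [div_eq_mul_inv, div_eq_mul_inv, ← mul_sub, norm_mul, ← Real.rpow_neg (norm_nonneg _),
      ← Real.rpow_neg (norm_nonneg _), mul_comm]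
    refine mul_le_mul_of_nonneg_right (h3.trans ?_) (norm_nonneg _)
    exact mul_le_mul_of_nonneg_left h4 (by positivity)
  rw [hsplit, hsplit, add_sub_add_comm, add_mul]
  exact (abs_add_le _ _).trans (add_le_add (hL x z hx hz) h2)

lemma exists_div_le_integral_div {n : ℕ} (hn : 1 ≤ n) {p : ℝ} (hp : 0 ≤ p) (hpn : p < n)
    {g : EuclideanSpace ℝ (Fin n) → ℝ} (hg : Continuous g) (hgi : Integrable g)
    (hpos : ∀ y, 0 < g y) :
    ∃ c : ℝ, 0 < c ∧ ∀ x, c / (‖x‖ + 1) ^ p ≤ ∫ y, g y / ‖x - y‖ ^ p := by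
  have hi : Integrable (fun y => g y / (‖y‖ + 1) ^ p) := by
    refine hgi.mono' ((hg.measurable.div (by fun_prop)).aestronglyMeasurable)
      (.of_forall fun y => ?_)
    rw [Real.norm_of_nonneg (div_nonneg (hpos y).le (by positivity))]
    exact div_le_self (hpos y).le
      (Real.one_le_rpow (by linarith [norm_nonneg y]) hp)
  refine ⟨∫ y, g y / (‖y‖ + 1) ^ p, integral_pos_of_ae_pos hi
    (.of_forall fun y => div_pos (hpos y) (by positivity)), fun x => ?_⟩
  rw [← integral_div]
  refine integral_mono_ae (hi.div_const _)
    (Integrable.div_norm_sub_rpow hn hp hpn hgi hg.bddOnBalls x) ?_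
  filter_upwards [ae_ne_point hn x] with y hy
  have hxy : 0 < ‖x - y‖ := norm_pos_iff.2 (sub_ne_zero.2 hy)
  have h1 : ‖x - y‖ ≤ (‖y‖ + 1) * (‖x‖ + 1) := by
    nlinarith [norm_sub_le x y, norm_nonneg x, norm_nonneg y,
      mul_nonneg (norm_nonneg x) (norm_nonneg y)]
  rw [div_div, ← Real.mul_rpow (by positivity) (by positivity)]
  have := (hpos y).le
  gcongr

lemma IsLogPotential.neg_log_le {n : ℕ} (hn : 2 ≤ n) {β C : ℝ} (hβ : 0 < β)
    {f u : EuclideanSpace ℝ (Fin n) → ℝ} (hf : Integrable f) (hb : BddOnBalls f)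
    (hf0 : ∀ y, 0 ≤ f y) (hT : ∫ y, f y = 2 * β) (hu : IsLogPotential β C f u)
    (x : EuclideanSpace ℝ (Fin n)) : -(2 * Real.log (‖x‖ + 1)) + C ≤ u x := by
  have h : ∫ y, -Real.log (‖x‖ + 1) * f y ≤ ∫ y, Real.log ((‖y‖ + 1) / ‖x - y‖) * f y := by
    refine integral_mono_ae (hf.const_mul _) (integrable_log_mul hn hf hb x) ?_
    filter_upwards [ae_ne_point (by omega) x] with y hy
    exact mul_le_mul_of_nonneg_right (neg_log_norm_add_one_le hy) (hf0 y)
  rw [integral_const_mul, hT] at h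
  rw [hu x]
  have h2 := mul_le_mul_of_nonneg_left h (one_div_pos.2 hβ).le
  have h3 : 1 / β * (-Real.log (‖x‖ + 1) * (2 * β)) = -(2 * Real.log (‖x‖ + 1)) := by
    field_simp
  linarith

lemma betaN_pos {n : ℕ} (hn : 1 ≤ n) : 0 < betaN n := by
  have h0 : (0 : ℝ) < n := by exact_mod_cast hn
  have h1 := Real.Gamma_pos_of_pos (show 0 < (n : ℝ) / 2 + 1 by positivity)
  have h2 := Real.Gamma_pos_of_pos (show 0 < (n : ℝ) / 2 by positivity)
  have h3 : 0 < (volume (ball (0 : EuclideanSpace ℝ (Fin n)) 1)).toReal :=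
    ENNReal.toReal_pos (measure_ball_pos _ _ one_pos).ne' measure_ball_lt_top.ne
  unfold betaN
  positivity

theorem moving_spheres_start (n : ℕ) (hn : 2 ≤ n) (μ : ℝ) (hμ0 : 0 < μ) (hμn : μ < n)
    (u : EuclideanSpace ℝ (Fin n) → ℝ) (hu : ContDiff ℝ n u)
    (hB : CondB n μ u) (hIE : IE n μ u) :
    ∃ l₀ > (0 : ℝ), ∀ l : ℝ, l₀ ≤ l → ∀ x : EuclideanSpace ℝ (Fin n),
      0 < ‖x‖ → ‖x‖ < l →
      0 ≤ wMS n u 0 l x ∧ 0 ≤ zMS n μ u 0 l x := by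
  have hn1 : 1 ≤ n := by omega
  have hu1 : ContDiff ℝ 1 u := hu.of_le (by exact_mod_cast hn1)
  obtain ⟨hgi, hD⟩ := hB
  obtain ⟨C, hC⟩ := hIE
  set g : EuclideanSpace ℝ (Fin n) → ℝ := fun y => Real.exp ((2 * n - μ) / 2 * u y) with hg
  have hgC : ContDiff ℝ 1 g := (contDiff_const.mul hu1).exp
  have hgpos : ∀ y, 0 < g y := fun y => Real.exp_pos _
  have hgb := hgC.continuous.bddOnBalls
  have hVb : BddOnBalls (V n μ u) := bddOnBalls_integral_div hn1 hμ0.le hμn hgi hgb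
  obtain ⟨c, hc0, hc⟩ := exists_div_le_integral_div hn1 hμ0.le hμn hgC.continuous hgi hgpos
  have hVpos : ∀ x, 0 < V n μ u x := fun x => lt_of_lt_of_le (by positivity) (hc x)
  set f : EuclideanSpace ℝ (Fin n) → ℝ := fun x => V n μ u x * g x with hf
  have hfpos : ∀ x, 0 < f x := fun x => mul_pos (hVpos x) (hgpos x)
  have hfi : Integrable f := by
    have h := hD
    rw [Measure.volume_eq_prod] at h
    refine h.integral_prod_left.congr (.of_forall fun x => ?_)
    change (∫ y, g x * g y / ‖x - y‖ ^ μ) = (∫ y, g y / ‖x - y‖ ^ μ) * g x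
    rw [mul_comm _ (g x), ← integral_const_mul]
    congr 1 with y
    exact mul_div_assoc _ _ _
  have hfb : BddOnBalls f := hVb.mul hgb
  have hlog : IsLogPotential (betaN n) C f u := hC
  have hT := hlog.integral_eq_two_mul hn hμ0 hμn (betaN_pos hn1) hu1 hg hgi hD rfl hfi hfb hfpos
  obtain ⟨L, hL0, hL⟩ := exists_lipschitz_closedBall hu1 (1 / 2)
  obtain ⟨l₁, hl₁, h₁⟩ := exists_forall_log_reflection_nonneg
    (hlog.neg_log_le hn (betaN_pos hn1) hfi hfb (fun y => (hfpos y).le) hT) hL0 hL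
  obtain ⟨L', hL'0, hL'⟩ := exists_lipschitz_integral_div hn1 hμ0 hμn hgC hgi
  obtain ⟨l₂, hl₂, h₂⟩ := exists_forall_rpow_reflection_nonneg (v := V n μ u) hμ0 hc0 hc hL'0 hL'
  refine ⟨max l₁ l₂, lt_max_of_lt_left hl₁, fun l hl x hx hxl => ?_⟩
  rw [wMS, zMS, zero_add, zero_add]
  exact ⟨h₁ l ((le_max_left _ _).trans hl) x hx hxl, h₂ l ((le_max_right _ _).trans hl) x hx hxl⟩
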